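/- arXiv:2604.04505 — 2 statements merged into one kernel-verified Lean document; each statement's English description precedes it below -/
import Mathlib

section
/- Let K be an algebraically closed field, A a finite dimensional K-algebra, and θ an integer-valued stability function (lattice point) on mod A. If the torsion class \bar T_θ is compact, then \bar T_θ is cocompact. -/
namespace TorsPaper

variable (A : Type) [Ring A]

/-- `N` is (isomorphic to) a factor module of `M`. -/
def IsQuotientOf (N M : ModuleCat.{0} A) : Prop :=
  ∃ f : M →ₗ[A] N, Function.Surjective f

/-- `L` is (isomorphic to) a submodule of `M`. -/
def IsSubmoduleOf (L M : ModuleCat.{0} A) : Prop :=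
  ∃ f : L →ₗ[A] M, Function.Injective f

/-- `M` is a nonzero module. -/
def Nonzero (M : ModuleCat.{0} A) : Prop := ∃ x : M, x ≠ 0

/-- A torsion class in `mod A`: a class of finitely generated modules, containing the zero
modules, closed under isomorphisms (which follows from `quot`), factor modules and
extensions. -/
structure IsTorsionClass (T : ModuleCat.{0} A → Prop) : Prop where
  fin : ∀ M, T M → Module.Finite A M
  zero : ∀ M : ModuleCat.{0} A, (∀ x : M, x = 0) → T M
  quot : ∀ M N : ModuleCat.{0} A, T M → Module.Finite A N → IsQuotientOf A N M → T N
  ext : ∀ M : ModuleCat.{0} A, Module.Finite A M → ∀ N : Submodule A M,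
    T (ModuleCat.of A N) → T (ModuleCat.of A (M ⧸ N)) → T M

/-- A torsion-free class in `mod A`. -/
structure IsTorsionFreeClass (F : ModuleCat.{0} A → Prop) : Prop where
  fin : ∀ M, F M → Module.Finite A M
  zero : ∀ M : ModuleCat.{0} A, (∀ x : M, x = 0) → F M
  sub : ∀ M N : ModuleCat.{0} A, F M → Module.Finite A N → IsSubmoduleOf A N M → F N
  ext : ∀ M : ModuleCat.{0} A, Module.Finite A M → ∀ N : Submodule A M,
    F (ModuleCat.of A N) → F (ModuleCat.of A (M ⧸ N)) → F M

/-- The right Hom-perpendicular class `T^⊥` inside `mod A`. -/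
def rightPerp (T : ModuleCat.{0} A → Prop) : ModuleCat.{0} A → Prop :=
  fun X => Module.Finite A X ∧ ∀ M : ModuleCat.{0} A, T M → ∀ f : M →ₗ[A] X, f = 0

/-- The smallest torsion class containing a class `S` of modules. -/
def torsClosure (S : ModuleCat.{0} A → Prop) : ModuleCat.{0} A → Prop :=
  fun X => ∀ T : ModuleCat.{0} A → Prop, IsTorsionClass A T → (∀ Y, S Y → T Y) → T X

/-- The smallest torsion-free class containing a class `S` of modules. -/
def torfClosure (S : ModuleCat.{0} A → Prop) : ModuleCat.{0} A → Prop :=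
  fun X => ∀ F : ModuleCat.{0} A → Prop, IsTorsionFreeClass A F → (∀ Y, S Y → F Y) → F X

/-- A torsion class is compact if it is the smallest torsion class containing a single
module `M`. -/
def IsCompactTors (T : ModuleCat.{0} A → Prop) : Prop :=
  ∃ M : ModuleCat.{0} A, Module.Finite A M ∧ T = torsClosure A (fun X => X = M)

/-- A torsion class is cocompact if `T^⊥` is the smallest torsion-free class containing a
single module `N`. -/
def IsCocompactTors (T : ModuleCat.{0} A → Prop) : Prop :=
  ∃ N : ModuleCat.{0} A, Module.Finite A N ∧ rightPerp A T = torfClosure A (fun X => X = N)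

/-- A torsion class is bicompact if it is both compact and cocompact. -/
def IsBicompactTors (T : ModuleCat.{0} A → Prop) : Prop :=
  IsCompactTors A T ∧ IsCocompactTors A T

/-- A class `C` of modules is functorially finite in `mod A` if every finitely generated
module has a left `C`-approximation and a right `C`-approximation. -/
def FunctoriallyFinite (C : ModuleCat.{0} A → Prop) : Prop :=
  (∀ M : ModuleCat.{0} A, Module.Finite A M →
    ∃ (X : ModuleCat.{0} A) (f : M →ₗ[A] X), C X ∧
      ∀ Y : ModuleCat.{0} A, C Y → ∀ g : M →ₗ[A] Y, ∃ h : X →ₗ[A] Y, h.comp f = g) ∧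
  (∀ M : ModuleCat.{0} A, Module.Finite A M →
    ∃ (X : ModuleCat.{0} A) (f : X →ₗ[A] M), C X ∧
      ∀ Y : ModuleCat.{0} A, C Y → ∀ g : Y →ₗ[A] M, ∃ h : Y →ₗ[A] X, f.comp h = g)

/-- A stability function: a real-valued function on `mod A` which is additive on short
exact sequences. -/
def IsStability (θ : ModuleCat.{0} A → ℝ) : Prop :=
  ∀ L M N : ModuleCat.{0} A, Module.Finite A L → Module.Finite A M → Module.Finite A N →
    ∀ (f : L →ₗ[A] M) (g : M →ₗ[A] N), Function.Injective f → Function.Surjective g →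
      LinearMap.range f = LinearMap.ker g → θ M = θ L + θ N

/-- The semistable torsion class `T_θ`. -/
def tTheta (θ : ModuleCat.{0} A → ℝ) : ModuleCat.{0} A → Prop :=
  fun M => Module.Finite A M ∧ ∀ N : ModuleCat.{0} A, Module.Finite A N →
    IsQuotientOf A N M → Nonzero A N → 0 < θ N

/-- The semistable torsion class `\bar T_θ`. -/
def tThetaBar (θ : ModuleCat.{0} A → ℝ) : ModuleCat.{0} A → Prop :=
  fun M => Module.Finite A M ∧ ∀ N : ModuleCat.{0} A, Module.Finite A N →
    IsQuotientOf A N M → 0 ≤ θ N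

/-- The semistable torsion-free class `F_θ`. -/
def fTheta (θ : ModuleCat.{0} A → ℝ) : ModuleCat.{0} A → Prop :=
  fun M => Module.Finite A M ∧ ∀ L : ModuleCat.{0} A, Module.Finite A L →
    IsSubmoduleOf A L M → Nonzero A L → θ L < 0

/-- The semistable torsion-free class `\bar F_θ`. -/
def fThetaBar (θ : ModuleCat.{0} A → ℝ) : ModuleCat.{0} A → Prop :=
  fun M => Module.Finite A M ∧ ∀ L : ModuleCat.{0} A, Module.Finite A L →
    IsSubmoduleOf A L M → θ L ≤ 0

/-- An integer-valued function on `mod A` additive on short exact sequences; these are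
exactly the group homomorphisms `K0(mod A) → ℤ`. -/
def IsAdditiveZ (φ : ModuleCat.{0} A → ℤ) : Prop :=
  ∀ L M N : ModuleCat.{0} A, Module.Finite A L → Module.Finite A M → Module.Finite A N →
    ∀ (f : L →ₗ[A] M) (g : M →ₗ[A] N), Function.Injective f → Function.Surjective g →
      LinearMap.range f = LinearMap.ker g → φ M = φ L + φ N

/-- `[X] = [Y]` in the Grothendieck group `K0(mod A)`: since `K0(mod A)` is free abelian
on the simple modules, this holds iff all additive `ℤ`-valued functions agree on `X`, `Y`. -/
def SameK0Class (X Y : ModuleCat.{0} A) : Prop :=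
  ∀ φ : ModuleCat.{0} A → ℤ, IsAdditiveZ A φ → φ X = φ Y

/-- Two classes of modules are numerically disjoint if they contain no nonzero `X`, `Y`
with `[X] = [Y] ≠ 0` in `K0(mod A)`. -/
def NumericallyDisjoint (C D : ModuleCat.{0} A → Prop) : Prop :=
  ¬ ∃ X Y : ModuleCat.{0} A, C X ∧ D Y ∧ Nonzero A X ∧ Nonzero A Y ∧ SameK0Class A X Y

/-- A brick: a finitely generated module whose endomorphism algebra is a division algebra,
i.e. `M` is nonzero and every nonzero endomorphism is invertible. -/
def IsBrick (M : ModuleCat.{0} A) : Prop :=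
  Module.Finite A M ∧ Nonzero A M ∧ ∀ f : M →ₗ[A] M, f ≠ 0 → Function.Bijective f

/-- A semibrick: a set of pairwise Hom-orthogonal bricks. -/
def IsSemibrick (S : Set (ModuleCat.{0} A)) : Prop :=
  (∀ M ∈ S, IsBrick A M) ∧
    ∀ M ∈ S, ∀ N ∈ S, M ≠ N → ∀ f : M →ₗ[A] N, f = 0



/-- Rank factorization over a division ring. -/
lemma exists_rank_factor {D : Type} [DivisionRing D] {m n : Type} [Fintype m] [Fintype n]
    [DecidableEq m] [DecidableEq n] (M : Matrix m n D) :
    ∃ (r : ℕ) (C : Matrix m (Fin r) D) (E : Matrix (Fin r) n D)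
      (C' : Matrix (Fin r) m D) (E' : Matrix n (Fin r) D),
      C * E = M ∧ C' * C = 1 ∧ E * E' = 1 := by
  set f := M.toLinearMapRight' with hf
  let r := Module.finrank D (LinearMap.range f)
  let b : Module.Basis (Fin r) D (LinearMap.range f) := Module.finBasis D _
  let φ : LinearMap.range f ≃ₗ[D] (Fin r → D) := b.equivFun
  let c : (m → D) →ₗ[D] (Fin r → D) := φ.toLinearMap ∘ₗ f.rangeRestrict
  let e : (Fin r → D) →ₗ[D] (n → D) := (LinearMap.range f).subtype ∘ₗ φ.symm.toLinearMap
  have hc : LinearMap.range c = ⊤ := by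
    rw [LinearMap.range_eq_top]
    exact φ.surjective.comp f.surjective_rangeRestrict
  have he : LinearMap.ker e = ⊥ := by
    rw [LinearMap.ker_eq_bot]
    exact (Submodule.injective_subtype _).comp φ.symm.injective
  obtain ⟨c', hc'⟩ := c.exists_rightInverse_of_surjective hc
  obtain ⟨e', he'⟩ := e.exists_leftInverse_of_injective he
  have hec : e ∘ₗ c = f := by
    ext x
    simp [e, c]
  refine ⟨r, Matrix.toLinearMapRight'.symm c, Matrix.toLinearMapRight'.symm e,
    Matrix.toLinearMapRight'.symm c', Matrix.toLinearMapRight'.symm e', ?_, ?_, ?_⟩ <;>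
  apply Matrix.toLinearMapRight'.injective
  · rw [Matrix.toLinearMapRight'_mul]; simp [hec, hf]
  · rw [Matrix.toLinearMapRight'_mul, Matrix.toLinearMapRight'_one]; simp [hc']
  · rw [Matrix.toLinearMapRight'_mul, Matrix.toLinearMapRight'_one]; simp [he']

/-- Matrices with a left-right inverse have rank at least the size of the identity. -/
lemma le_rank_of_mul_eq_one {F : Type} [Field F] {m n k : Type} [Fintype m] [Fintype n]
    [Fintype k] [DecidableEq k] (M : Matrix m n F) (P : Matrix k m F) (Q : Matrix n k F)
    (h : IsUnit (P * M * Q)) : Fintype.card k ≤ M.rank := by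
  rw [← Matrix.rank_of_isUnit _ h]
  exact (Matrix.rank_mul_le_left _ _).trans (Matrix.rank_mul_le_right _ _)

lemma rank_eq_of_factor {F : Type} [Field F] {m n k : Type} [Fintype m] [Fintype n]
    [Fintype k] [DecidableEq k] (M : Matrix m n F) (C : Matrix m k F) (E : Matrix k n F)
    (C' : Matrix k m F) (E' : Matrix n k F) (h : C * E = M) (hC : C' * C = 1) (hE : E * E' = 1) :
    M.rank = Fintype.card k := by
  apply le_antisymm
  · rw [← h]
    exact (Matrix.rank_mul_le_left _ _).trans (Matrix.rank_le_card_width _)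
  · apply le_rank_of_mul_eq_one M C' E'
    have : C' * M * E' = 1 := by
      rw [← h]
      calc C' * (C * E) * E' = (C' * C) * (E * E') := by simp only [Matrix.mul_assoc]
        _ = 1 := by rw [hC, hE, one_mul]
    rw [this]; exact isUnit_one

lemma exists_unit_of_rank {F : Type} [Field F] {m n : Type} [Fintype m] [Fintype n]
    [DecidableEq m] [DecidableEq n] (M : Matrix m n F) :
    ∃ (P : Matrix (Fin M.rank) m F) (Q : Matrix n (Fin M.rank) F), P * M * Q = 1 := by
  obtain ⟨r, C, E, C', E', h, hC, hE⟩ := exists_rank_factor M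
  have hr := rank_eq_of_factor M C E C' E' h hC hE
  rw [Fintype.card_fin] at hr
  rw [hr]
  refine ⟨C', E', ?_⟩
  rw [← h]
  calc C' * (C * E) * E' = (C' * C) * (E * E') := by simp only [Matrix.mul_assoc]
    _ = 1 := by rw [hC, hE, one_mul]

/-- Rank is unchanged by field extension. -/
lemma rank_map_field {K F : Type} [Field K] [Field F] (i : K →+* F) {m n : Type} [Fintype m]
    [Fintype n] [DecidableEq m] [DecidableEq n] (M : Matrix m n K) :
    (M.map i).rank = M.rank := by
  obtain ⟨r, C, E, C', E', h, hC, hE⟩ := exists_rank_factor M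
  rw [rank_eq_of_factor M C E C' E' h hC hE]
  apply rank_eq_of_factor (M.map i) (C.map i) (E.map i) (C'.map i) (E'.map i)
  · rw [← Matrix.map_mul, h]
  · rw [← Matrix.map_mul, hC]; simp
  · rw [← Matrix.map_mul, hE]; simp

/-- Maximal ranks in a linear family over `F` are attained at points with coordinates in the
infinite subfield `K`. -/
lemma exists_point_rank {K F : Type} [Field K] [Infinite K] [Field F] [Algebra K F]
    {m n N : Type} [Fintype m] [Fintype n] [Fintype N]
    [DecidableEq m] [DecidableEq n] (C : N → Matrix m n F) (y0 : N → F) :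
    ∃ y : N → K, (∑ a, y0 a • C a).rank ≤ (∑ a, algebraMap K F (y a) • C a).rank := by
  obtain ⟨P, Q, h⟩ := exists_unit_of_rank (∑ a, y0 a • C a)
  generalize (∑ a, y0 a • C a).rank = r at P Q h ⊢
  let S : Matrix m n (MvPolynomial N F) :=
    ∑ a, (MvPolynomial.X a : MvPolynomial N F) • (C a).map (MvPolynomial.C (σ := N))
  let G : MvPolynomial N F := Matrix.det (P.map (MvPolynomial.C (σ := N)) * S *
      Q.map (MvPolynomial.C (σ := N)))
  have hG : ∀ y : N → F, MvPolynomial.eval y G = (P * (∑ a, y a • C a) * Q).det := by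
    intro y
    simp only [G, RingHom.map_det]
    congr 1
    rw [RingHom.mapMatrix_apply, Matrix.map_mul, Matrix.map_mul]
    congr 1
    · congr 1
      · ext i j; simp
      · ext i j; simp [S, Matrix.sum_apply]
    · ext i j; simp
  by_contra hcon
  push Not at hcon
  have h0 : G = 0 := by
    apply MvPolynomial.funext_set (fun _ => Set.range (algebraMap K F))
    · intro _; exact Set.infinite_range_of_injective (algebraMap K F).injective
    · intro x hx
      rw [map_zero]
      by_contra hne
      have : ∀ a, ∃ z, algebraMap K F z = x a := fun a => hx a (Set.mem_univ a)
      choose z hz using this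
      have h1 := hcon z
      simp only [hz] at h1
      rw [hG] at hne
      have h2 := le_rank_of_mul_eq_one (∑ a, x a • C a) P Q
        ((Matrix.isUnit_iff_isUnit_det _).2 (isUnit_iff_ne_zero.2 hne))
      rw [Fintype.card_fin] at h2
      omega
  have := hG y0
  rw [h0, h] at this
  simp at this


/-- The coefficient field: Hahn series in two variables, ordered lexicographically. -/
abbrev HF (K : Type) [Field K] : Type := HahnSeries (ℤ ×ₗ ℤ) K

/-- Rescaling of coefficients of Hahn series by a character of the exponent group. -/
noncomputable def tw {K : Type} [Field K] (χ : AddChar (ℤ ×ₗ ℤ) K) : HF K →+* HF K where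
  toFun x := ⟨fun g => χ g * x.coeff g, x.isPWO_support.mono (by
    intro g hg
    simp only [Function.mem_support] at hg
    exact fun h => hg (by rw [h, mul_zero]))⟩
  map_one' := by
    ext g
    simp only [HahnSeries.coeff_one]
    split_ifs with h
    · rw [h]; simp
    · simp
  map_zero' := by ext g; simp
  map_add' x y := by ext g; simp [mul_add]
  map_mul' x y := by
    ext g
    simp only [HahnSeries.coeff_mul, Finset.mul_sum]
    apply Finset.sum_congr
    · ext ij
      simp only [Finset.mem_antidiagonal, HahnSeries.mem_support]
      have h1 : ∀ g, χ g ≠ 0 := fun g => (χ.val_isUnit g).ne_zero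
      simp [h1]
    · intro ij hij
      rw [Finset.mem_antidiagonal] at hij
      rw [← hij.2.2, χ.map_add_eq_mul]
      ring

@[simp] lemma tw_coeff {K : Type} [Field K] (χ : AddChar (ℤ ×ₗ ℤ) K) (x : HF K) (g : ℤ ×ₗ ℤ) :
    (tw χ x).coeff g = χ g * x.coeff g := rfl

lemma coeff_mul_low {K : Type} [Field K] (x y : HF K) (g h : ℤ ×ₗ ℤ)
    (hx : ∀ g' < g, x.coeff g' = 0) (hy : ∀ h' < h, y.coeff h' = 0) :
    (x * y).coeff (g + h) = x.coeff g * y.coeff h := by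
  rw [HahnSeries.coeff_mul]
  rw [Finset.sum_eq_single (g, h)]
  · rintro ⟨a, b⟩ hab hne
    rw [Finset.mem_antidiagonal] at hab
    obtain ⟨h1, h2, h3⟩ := hab
    simp only at h1 h2 h3
    exfalso
    rcases lt_trichotomy a g with hlt | heq | hgt
    · exact h1 (hx a hlt)
    · subst heq
      have : b = h := add_left_cancel h3
      exact hne (by rw [this])
    · have : b < h := by
        by_contra hb
        push Not at hb
        exact absurd h3 (add_lt_add_of_lt_of_le hgt hb).ne'
      exact h2 (hy b this)
  · intro hn
    rw [Finset.mem_antidiagonal] at hn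
    simp only [HahnSeries.mem_support, and_true] at hn
    by_contra hc
    exact hn ⟨left_ne_zero_of_mul hc, right_ne_zero_of_mul hc⟩

/-- Finite nonzero families of Hahn series have a common lowest exponent. -/
lemma exists_low {K : Type} [Field K] {I : Type} [Finite I] (v : I → HF K) (hv : v ≠ 0) :
    ∃ g : ℤ ×ₗ ℤ, (∀ i, ∀ g' < g, (v i).coeff g' = 0) ∧ ∃ i, (v i).coeff g ≠ 0 := by
  have := Fintype.ofFinite I
  classical
  let s : Finset I := Finset.univ.filter (fun i => v i ≠ 0)
  have hs : s.Nonempty := by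
    obtain ⟨i, hi⟩ := Function.ne_iff.1 hv
    exact ⟨i, by simpa [s] using hi⟩
  obtain ⟨i, his, hi⟩ := s.exists_min_image (fun i => (v i).order) hs
  refine ⟨(v i).order, ?_, i, ?_⟩
  · intro j g' hg'
    by_cases hj : v j = 0
    · simp [hj]
    · exact HahnSeries.coeff_eq_zero_of_lt_order (hg'.trans_le (hi j (by simpa [s] using hj)))
  · have : v i ≠ 0 := by simpa [s] using his
    exact fun h => this (HahnSeries.coeff_order_eq_zero.1 h)

/-- First character: `(i,k) ↦ ψ i`. -/
def chi1 {K : Type} [Field K] {l : ℕ} (ψ : AddChar (ZMod l) K) : AddChar (ℤ ×ₗ ℤ) K where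
  toFun g := ψ (((ofLex g).1 : ℤ) : ZMod l)
  map_zero_eq_one' := by simp
  map_add_eq_mul' a b := by simp [AddChar.map_add_eq_mul]

/-- Second character: `(i,k) ↦ ψ k`. -/
def chi2 {K : Type} [Field K] {l : ℕ} (ψ : AddChar (ZMod l) K) : AddChar (ℤ ×ₗ ℤ) K where
  toFun g := ψ (((ofLex g).2 : ℤ) : ZMod l)
  map_zero_eq_one' := by simp
  map_add_eq_mul' a b := by simp [AddChar.map_add_eq_mul]

/-- The twisted-fixed subring of the matrix ring (a cyclic division algebra). -/
noncomputable def DD {K : Type} [Field K] {l : ℕ} [NeZero l] (ψ : AddChar (ZMod l) K) :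
    Subring (Matrix (ZMod l) (ZMod l) (HF K)) where
  carrier := {M | (∀ i j, M (i + 1) (j + 1) = tw (chi1 ψ) (M i j)) ∧
    (∀ i j, HahnSeries.C (ψ i) * tw (chi2 ψ) (M i j) = HahnSeries.C (ψ j) * M i j)}
  mul_mem' := by
    rintro M N ⟨h1, h2⟩ ⟨h3, h4⟩
    constructor
    · intro i j
      simp only [Matrix.mul_apply, map_sum, map_mul]
      rw [← Equiv.sum_comp (Equiv.addRight (1 : ZMod l))]
      simp [h1, h3]
    · intro i j
      simp only [Matrix.mul_apply, map_sum, map_mul, Finset.mul_sum]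
      apply Finset.sum_congr rfl
      intro k _
      calc HahnSeries.C (ψ i) * (tw (chi2 ψ) (M i k) * tw (chi2 ψ) (N k j))
          = (HahnSeries.C (ψ i) * tw (chi2 ψ) (M i k)) * tw (chi2 ψ) (N k j) := by ring
        _ = M i k * (HahnSeries.C (ψ k) * tw (chi2 ψ) (N k j)) := by rw [h2]; ring
        _ = _ := by rw [h4]; ring
  one_mem' := by
    constructor
    · intro i j
      simp only [Matrix.one_apply, add_left_inj]
      split_ifs <;> simp
    · intro i j
      simp only [Matrix.one_apply]
      split_ifs with h
      · simp [h]
      · simp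
  zero_mem' := by constructor <;> intro i j <;> simp
  add_mem' := by
    rintro M N ⟨h1, h2⟩ ⟨h3, h4⟩
    constructor
    · intro i j; simp [h1, h3]
    · intro i j; simp only [Matrix.add_apply, map_add, mul_add, h2, h4]
  neg_mem' := by
    rintro M ⟨h1, h2⟩
    constructor
    · intro i j; simp [h1]
    · intro i j; simp only [Matrix.neg_apply, map_neg, mul_neg, h2]

lemma mem_DD {K : Type} [Field K] {l : ℕ} [NeZero l] (ψ : AddChar (ZMod l) K)
    (M : Matrix (ZMod l) (ZMod l) (HF K)) : M ∈ DD ψ ↔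
    (∀ i j, M (i + 1) (j + 1) = tw (chi1 ψ) (M i j)) ∧
    (∀ i j, HahnSeries.C (ψ i) * tw (chi2 ψ) (M i j) = HahnSeries.C (ψ j) * M i j) := Iff.rfl

lemma DD_isUnit {K : Type} [Field K] {l : ℕ} [NeZero l] (ψ : AddChar (ZMod l) K)
    (hψ : Function.Injective ψ) (M : Matrix (ZMod l) (ZMod l) (HF K)) (hM : M ∈ DD ψ)
    (h0 : M ≠ 0) : IsUnit M := by
  rw [← Matrix.mulVec_injective_iff_isUnit]
  rw [mem_DD] at hM
  obtain ⟨h1, h2⟩ := hM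
  obtain ⟨g, hg, ⟨⟨i0, j0⟩, hij⟩⟩ := exists_low (fun p : ZMod l × ZMod l => M p.1 p.2) (by
    intro h; apply h0; ext1 i j; exact congrFun h (i, j))
  simp only at hij
  set k : ZMod l := (((ofLex g).2 : ℤ) : ZMod l) with hk
  have hz : ∀ i j, j ≠ i + k → (M i j).coeff g = 0 := by
    intro i j hne
    have := congrArg (fun x => x.coeff g) (h2 i j)
    simp only [HahnSeries.C_mul_eq_smul, HahnSeries.coeff_smul, tw_coeff, smul_eq_mul] at this
    by_contra hc
    rw [← mul_assoc] at this
    have h3 := mul_right_cancel₀ hc this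
    have : chi2 ψ g = ψ k := rfl
    rw [this, ← ψ.map_add_eq_mul] at h3
    exact hne (hψ h3).symm
  have hshift : ∀ i j, (M i j).coeff g ≠ 0 → (M (i + 1) (j + 1)).coeff g ≠ 0 := by
    intro i j h
    rw [h1, tw_coeff]
    exact mul_ne_zero ((chi1 ψ).val_isUnit g).ne_zero h
  have hshift2 : ∀ n : ℕ, (M (i0 + n) (j0 + n)).coeff g ≠ 0 := by
    intro n
    induction n with
    | zero => simpa using hij
    | succ n ih =>
      have := hshift _ _ ih
      push_cast
      rwa [← add_assoc, ← add_assoc]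
  have hj0 : j0 = i0 + k := by
    by_contra h
    exact hij (hz _ _ h)
  have hnz : ∀ i, (M i (i + k)).coeff g ≠ 0 := by
    intro i
    have := hshift2 (i - i0).val
    rw [ZMod.natCast_zmod_val, hj0] at this
    convert this using 3 <;> ring
  rw [← Matrix.coe_mulVecLin, ← LinearMap.ker_eq_bot, LinearMap.ker_eq_bot']
  intro v hv
  by_contra hv0
  obtain ⟨h, hh, j, hj⟩ := exists_low v hv0
  have h5 := congrArg (fun x => x.coeff (g + h)) (congrFun hv (j - k))
  simp only [Matrix.mulVecLin_apply, Matrix.mulVec, dotProduct, HahnSeries.coeff_sum] at h5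
  rw [Finset.sum_eq_single j] at h5
  · rw [coeff_mul_low _ _ _ _ (fun g' hg' => hg (j - k, j) g' hg') (hh j)] at h5
    have := hnz (j - k)
    rw [sub_add_cancel] at this
    exact mul_ne_zero this hj (by simpa using h5)
  · intro b _ hb
    rw [coeff_mul_low _ _ _ _ (fun g' hg' => hg (j - k, b) g' hg') (hh b), hz, zero_mul]
    intro h; exact hb (by simpa using h)
  · simp

lemma DD_inv_mem {K : Type} [Field K] {l : ℕ} [NeZero l] (ψ : AddChar (ZMod l) K)
    (M N : Matrix (ZMod l) (ZMod l) (HF K)) (hM : M ∈ DD ψ) (h : M * N = 1) : N ∈ DD ψ := by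
  rw [mem_DD] at hM ⊢
  obtain ⟨h1, h2⟩ := hM
  have h' : N * M = 1 := mul_eq_one_comm.1 h
  constructor
  · have e1 : M.submatrix (· + 1) (· + 1) = M.map (tw (chi1 ψ)) := by
      ext1 i j; simp [h1]
    have e2 : M.submatrix (Equiv.addRight (1 : ZMod l)) (Equiv.addRight (1 : ZMod l)) *
        N.submatrix (Equiv.addRight (1 : ZMod l)) (Equiv.addRight (1 : ZMod l)) = 1 := by
      rw [Matrix.submatrix_mul_equiv, h, Matrix.submatrix_one_equiv]
    have e3 : N.map (tw (chi1 ψ)) * M.map (tw (chi1 ψ)) = 1 := by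
      rw [← Matrix.map_mul, h']; simp
    have e4 : N.map (tw (chi1 ψ)) =
        N.submatrix (Equiv.addRight (1 : ZMod l)) (Equiv.addRight (1 : ZMod l)) := by
      apply left_inv_eq_right_inv e3
      rw [← e2, ← e1]; rfl
    intro i j
    exact (congrFun (congrFun e4 i) j).symm
  · let X : Matrix (ZMod l) (ZMod l) (HF K) := Matrix.diagonal (fun i => HahnSeries.C (ψ i))
    have e1 : X * M.map (tw (chi2 ψ)) = M * X := by
      ext1 i j
      rw [Matrix.diagonal_mul, Matrix.mul_diagonal, Matrix.map_apply, h2, mul_comm]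
    have e3 : M.map (tw (chi2 ψ)) * N.map (tw (chi2 ψ)) = 1 := by
      rw [← Matrix.map_mul, h]; simp
    have e4 : X * N.map (tw (chi2 ψ)) = N * X := by
      calc X * N.map (tw (chi2 ψ)) = (N * M) * X * N.map (tw (chi2 ψ)) := by rw [h', one_mul]
        _ = N * (M * X) * N.map (tw (chi2 ψ)) := by rw [mul_assoc N M X]
        _ = N * X * (M.map (tw (chi2 ψ)) * N.map (tw (chi2 ψ))) := by
          rw [← e1]; simp only [mul_assoc]
        _ = N * X := by rw [e3, mul_one]
    intro i j
    have := congrFun (congrFun e4 i) j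
    rw [Matrix.diagonal_mul, Matrix.mul_diagonal, Matrix.map_apply] at this
    rw [this, mul_comm]

/-- `DD ψ` is a division ring when `ψ` is injective. -/
@[reducible] noncomputable def DDdiv {K : Type} [Field K] {l : ℕ} [NeZero l] (ψ : AddChar (ZMod l) K)
    (hψ : Function.Injective ψ) : DivisionRing (DD ψ) :=
  DivisionRing.ofIsUnitOrEqZero (by
    intro a
    by_cases ha : a = 0
    · exact Or.inr ha
    · left
      have hu := DD_isUnit ψ hψ a.1 a.2 (fun h => ha (Subtype.ext h))
      obtain ⟨u, hu⟩ := hu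
      have h1 : a.1 * (↑u⁻¹ : Matrix (ZMod l) (ZMod l) (HF K)) = 1 := by rw [← hu]; simp
      have h2 : (↑u⁻¹ : Matrix (ZMod l) (ZMod l) (HF K)) * a.1 = 1 := by rw [← hu]; simp
      have hm := DD_inv_mem ψ a.1 _ a.2 h1
      exact ⟨⟨a, ⟨_, hm⟩, Subtype.ext h1, Subtype.ext h2⟩, rfl⟩)

/-- The standard elements of `DD ψ`. -/
noncomputable def stdD {K : Type} [Field K] {l : ℕ} [NeZero l] (ψ : AddChar (ZMod l) K)
    (p : ZMod l × ZMod l) : Matrix (ZMod l) (ZMod l) (HF K) :=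
  fun i j => if j = i + p.2 then
    HahnSeries.single (toLex ((p.1.val : ℤ), (p.2.val : ℤ))) (ψ (p.1 * i)) else 0

lemma stdD_mem {K : Type} [Field K] {l : ℕ} [NeZero l] (ψ : AddChar (ZMod l) K)
    (p : ZMod l × ZMod l) : stdD ψ p ∈ DD ψ := by
  rw [mem_DD]
  have key : ∀ (χ : AddChar (ℤ ×ₗ ℤ) K) (g : ℤ ×ₗ ℤ) (c : K),
      tw χ (HahnSeries.single g c) = HahnSeries.single g (χ g * c) := by
    intro χ g c
    ext g'
    rw [tw_coeff]
    by_cases h : g' = g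
    · subst h; simp
    · simp [HahnSeries.coeff_single_of_ne h]
  constructor
  · intro i j
    simp only [stdD]
    have : (j + 1 = i + 1 + p.2) ↔ (j = i + p.2) := by
      rw [add_right_comm]; simp
    simp only [this]
    split_ifs with h
    · rw [key]
      congr 1
      have : chi1 ψ (toLex ((p.1.val : ℤ), (p.2.val : ℤ))) = ψ p.1 := by
        show ψ (((p.1.val : ℤ)) : ZMod l) = ψ p.1
        simp
      rw [this, ← ψ.map_add_eq_mul]
      congr 1; ring
    · simp
  · intro i j
    simp only [stdD]
    split_ifs with h
    · rw [key]
      have : chi2 ψ (toLex ((p.1.val : ℤ), (p.2.val : ℤ))) = ψ p.2 := by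
        show ψ (((p.2.val : ℤ)) : ZMod l) = ψ p.2
        simp
      rw [this, HahnSeries.C_apply, HahnSeries.C_apply, HahnSeries.single_mul_single,
        HahnSeries.single_mul_single]
      congr 1
      rw [h, ψ.map_add_eq_mul]
      ring
    · simp

/-- Every scalar matrix is an `F`-combination of the standard elements. -/
lemma stdD_span {K : Type} [Field K] {l : ℕ} [NeZero l] (ψ : AddChar (ZMod l) K)
    (hψ : Function.Injective ψ) (hl : (l : K) ≠ 0) (x : Matrix (ZMod l) (ZMod l) K) :
    ∃ y : ZMod l × ZMod l → HF K, x.map (algebraMap K (HF K)) = ∑ p, y p • stdD ψ p := by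
  have hp : ψ.IsPrimitive := by
    intro a ha h
    have h1 := DFunLike.congr_fun h 1
    rw [AddChar.mulShift_apply, mul_one, AddChar.one_apply, ← ψ.map_zero_eq_one] at h1
    exact ha (hψ h1)
  refine ⟨fun p => HahnSeries.single (-toLex ((p.1.val : ℤ), (p.2.val : ℤ)))
    ((l : K)⁻¹ * ∑ i, ψ (-(p.1 * i)) * x i (i + p.2)), ?_⟩
  ext1 i j
  rw [Matrix.map_apply, Matrix.sum_apply]
  have h1 : ∀ p : ZMod l × ZMod l, ((HahnSeries.single (-toLex ((p.1.val : ℤ), (p.2.val : ℤ)))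
      ((l : K)⁻¹ * ∑ i, ψ (-(p.1 * i)) * x i (i + p.2)) : HF K) • stdD ψ p) i j =
      if p.2 = j - i then
        HahnSeries.C (Γ := ℤ ×ₗ ℤ) (((l : K)⁻¹ * ∑ i, ψ (-(p.1 * i)) * x i (i + p.2)) *
          ψ (p.1 * i)) else 0 := by
    intro p
    rw [Matrix.smul_apply, smul_eq_mul, stdD]
    have : j = i + p.2 ↔ p.2 = j - i := by
      constructor
      · intro h; rw [h]; ring
      · intro h; rw [h]; ring
    simp only [this]
    split_ifs with h
    · rw [HahnSeries.single_mul_single, neg_add_cancel, HahnSeries.C_apply]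
    · rw [mul_zero]
  rw [Finset.sum_congr rfl (fun p _ => h1 p), Fintype.sum_prod_type]
  simp only [Finset.sum_ite_eq', Finset.mem_univ, if_true]
  rw [← map_sum]
  have h2 : algebraMap K (HF K) (x i j) = HahnSeries.C (x i j) := rfl
  rw [h2]
  congr 1
  calc x i j = (l : K)⁻¹ * ∑ i', x i' (i' + (j - i)) * ∑ p, ψ (p * (i - i')) := by
        simp only [AddChar.sum_mulShift _ hp, sub_eq_zero, ZMod.card]
        simp [Finset.sum_ite_eq]
        field_simp
    _ = _ := by
        simp only [Finset.mul_sum, Finset.sum_mul]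
        rw [Finset.sum_comm]
        apply Finset.sum_congr rfl; intro a _
        apply Finset.sum_congr rfl; intro b _
        have : ψ (a * (i - b)) = ψ (-(a * b)) * ψ (a * i) := by
          rw [← ψ.map_add_eq_mul]; congr 1; ring
        rw [this]; ring


/-- Flattening a matrix of matrices. -/
def flat {F m n Λ : Type} (M : Matrix m n (Matrix Λ Λ F)) : Matrix (m × Λ) (n × Λ) F :=
  fun a b => M a.1 b.1 a.2 b.2

lemma flat_mul {F m n k Λ : Type} [Field F] [Fintype n] [Fintype Λ]
    (M : Matrix m n (Matrix Λ Λ F)) (N : Matrix n k (Matrix Λ Λ F)) :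
    flat (M * N) = flat M * flat N := by
  ext a b
  simp only [flat, Matrix.mul_apply, Matrix.sum_apply, Fintype.sum_prod_type]

lemma flat_one {F n Λ : Type} [Field F] [DecidableEq n] [DecidableEq Λ] :
    flat (1 : Matrix n n (Matrix Λ Λ F)) = 1 := by
  ext ⟨a, b⟩ ⟨c, d⟩
  simp only [flat, Matrix.one_apply, Prod.mk.injEq]
  by_cases h : a = c <;> simp [h, Matrix.one_apply]

/-- The rank of a matrix over a division subring of a matrix ring is divisible by the size. -/
lemma dvd_rank_of_division {F Λ m n D : Type} [Field F] [Fintype Λ] [DecidableEq Λ] [Fintype m]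
    [Fintype n] [DecidableEq m] [DecidableEq n] [DivisionRing D] (φ : D →+* Matrix Λ Λ F)
    (M : Matrix m n D) :
    Fintype.card Λ ∣ (flat (M.map φ)).rank := by
  obtain ⟨r, C, E, C', E', h, hC, hE⟩ := exists_rank_factor M
  rw [rank_eq_of_factor (flat (M.map φ)) (flat (C.map φ))
    (flat (E.map φ)) (flat (C'.map φ)) (flat (E'.map φ))]
  · rw [Fintype.card_prod]; exact Dvd.intro_left _ rfl
  · rw [← flat_mul, ← Matrix.map_mul, h]
  · rw [← flat_mul, ← Matrix.map_mul, hC, ← flat_one]; congr 1; simp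
  · rw [← flat_mul, ← Matrix.map_mul, hE, ← flat_one]; congr 1; simp

/-- The matrix `∑ B i ⊗ x i`. -/
def bigM {K F ι m n Λ : Type} [Field K] [Field F] [Algebra K F] [Fintype ι]
    (B : ι → Matrix m n K) (x : ι → Matrix Λ Λ F) : Matrix (m × Λ) (n × Λ) F :=
  fun a b => ∑ i, algebraMap K F (B i a.1 b.1) * x i a.2 b.2

/-- The regularity lemma: maximal ranks of blow-ups are divisible by the size. -/
lemma regularity {K ι m n : Type} [Field K] [IsAlgClosed K] [Fintype ι] [Fintype m] [Fintype n]
    [DecidableEq m] [DecidableEq n] (B : ι → Matrix m n K) (l : ℕ) [NeZero l] (hl : (l : K) ≠ 0)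
    (x : ι → Matrix (ZMod l) (ZMod l) K)
    (hx : ∀ x' : ι → Matrix (ZMod l) (ZMod l) K, (bigM B x').rank ≤ (bigM B x).rank) :
    l ∣ (bigM B x).rank := by
  classical
  have : Infinite K := IsAlgClosed.instInfinite
  -- the primitive character
  obtain ⟨ψ, hψ⟩ : ∃ ψ : AddChar (ZMod l) K, Function.Injective ψ := by
    have : NeZero (l : K) := ⟨hl⟩
    obtain ⟨ζ, hζ⟩ := HasEnoughRootsOfUnity.exists_primitiveRoot K l
    refine ⟨AddChar.zmodChar l hζ.pow_eq_one, ?_⟩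
    intro a b hab
    rw [AddChar.zmodChar_apply, AddChar.zmodChar_apply] at hab
    exact ZMod.val_injective l (hζ.pow_inj (ZMod.val_lt a) (ZMod.val_lt b) hab)
  have hbigM : ∀ x' : ι → Matrix (ZMod l) (ZMod l) K,
      (bigM B x').map (algebraMap K (HF K)) =
        bigM (F := HF K) B (fun i => (x' i).map (algebraMap K (HF K))) := by
    intro x'
    ext1 a b
    simp only [bigM, Matrix.map_apply, map_sum, map_mul]
    rfl
  -- an upper bound
  have hup : ∀ y : ι → Matrix (ZMod l) (ZMod l) (HF K),
      (bigM B y).rank ≤ (bigM B x).rank := by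
    intro y
    obtain ⟨z, hz⟩ := exists_point_rank (K := K)
      (fun q : ι × ZMod l × ZMod l =>
        bigM (F := HF K) B (fun i => if i = q.1 then Matrix.single q.2.1 q.2.2 1 else 0))
      (fun q => y q.1 q.2.1 q.2.2)
    have hsum : ∀ w : ι × ZMod l × ZMod l → HF K, (∑ q, w q •
        bigM (F := HF K) B (fun i => if i = q.1 then Matrix.single q.2.1 q.2.2 1 else 0)) =
        bigM B (fun i => fun c d => w (i, c, d)) := by
      intro w
      ext1 a b
      rw [Matrix.sum_apply]
      simp only [Matrix.smul_apply, bigM, smul_eq_mul, Fintype.sum_prod_type]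
      apply Finset.sum_congr rfl
      intro i _
      rw [Finset.sum_eq_single a.2, Finset.sum_eq_single b.2, Finset.sum_eq_single i]
      · simp [mul_comm]
      · intro j _ hj; simp [hj]
      · simp
      · intro d _ hd
        rw [Finset.sum_eq_zero, mul_zero]
        intro j _
        split_ifs
        · simp [Matrix.single_apply, hd]
        · simp
      · simp
      · intro c _ hc
        apply Finset.sum_eq_zero
        intro d _
        rw [Finset.sum_eq_zero, mul_zero]
        intro j _
        split_ifs
        · simp [Matrix.single_apply, hc]
        · simp
      · simp
    rw [hsum, hsum] at hz
    refine hz.trans ?_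
    have h1 := hx (fun i => Matrix.of (fun c d => z (i, c, d)))
    have h2 := hbigM (fun i => Matrix.of (fun c d => z (i, c, d)))
    have h3 := rank_map_field (algebraMap K (HF K))
      (bigM B (fun i => Matrix.of (fun c d => z (i, c, d))))
    rw [h2] at h3
    exact h3.le.trans h1
  -- a point in the division algebra
  have hsp : ∀ i, ∃ y : ZMod l × ZMod l → HF K,
      (x i).map (algebraMap K (HF K)) = ∑ p, y p • stdD ψ p :=
    fun i => stdD_span ψ hψ hl (x i)
  choose y hy using hsp
  obtain ⟨z, hz⟩ := exists_point_rank (K := K)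
      (fun q : ι × (ZMod l × ZMod l) =>
        bigM (F := HF K) B (fun i => if i = q.1 then stdD ψ q.2 else 0))
      (fun q => y q.1 q.2)
  have hsum : ∀ w : ι × (ZMod l × ZMod l) → HF K, (∑ q, w q •
        bigM (F := HF K) B (fun i => if i = q.1 then stdD ψ q.2 else 0)) =
        bigM B (fun i => ∑ p, w (i, p) • stdD ψ p) := by
    intro w
    ext1 a b
    rw [Matrix.sum_apply]
    simp only [Matrix.smul_apply, bigM, smul_eq_mul]
    refine (Fintype.sum_prod_type _).trans ?_
    apply Finset.sum_congr rfl
    intro i _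
    rw [Matrix.sum_apply, Finset.mul_sum]
    apply Finset.sum_congr rfl
    intro p _
    rw [Finset.sum_eq_single i]
    · simp; ring
    · intro j _ hj; simp [hj]
    · simp
  rw [hsum, hsum] at hz
  simp only [← hy] at hz
  rw [← hbigM, rank_map_field] at hz
  have hC : ∀ c : K, algebraMap K (HF K) c • (1 : Matrix (ZMod l) (ZMod l) (HF K)) ∈ DD ψ := by
    intro c
    rw [mem_DD]
    have h2 : ∀ χ : AddChar (ℤ ×ₗ ℤ) K, tw χ (algebraMap K (HF K) c) = algebraMap K (HF K) c := by
      intro χ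
      have : algebraMap K (HF K) c = HahnSeries.single 0 c := rfl
      rw [this]
      ext g
      rw [tw_coeff]
      by_cases h : g = 0
      · subst h; simp
      · simp [HahnSeries.coeff_single_of_ne h]
    constructor
    · intro i j
      simp only [Matrix.smul_apply, Matrix.one_apply, add_left_inj, smul_eq_mul]
      split_ifs <;> simp [h2]
    · intro i j
      simp only [Matrix.smul_apply, Matrix.one_apply, smul_eq_mul]
      split_ifs with h
      · simp [h, h2]
      · simp
  have hsmul : ∀ (c : K) (M : Matrix (ZMod l) (ZMod l) (HF K)), M ∈ DD ψ →
      algebraMap K (HF K) c • M ∈ DD ψ := by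
    intro c M hM
    have := (DD ψ).mul_mem (hC c) hM
    rwa [smul_mul_assoc, one_mul] at this
  let dm : Matrix m n (DD ψ) := fun a b =>
    ⟨∑ i, algebraMap K (HF K) (B i a b) • ∑ p, algebraMap K (HF K) (z (i, p)) • stdD ψ p,
      Subring.sum_mem _ fun i _ => hsmul _ _ (Subring.sum_mem _ fun p _ =>
        hsmul _ _ (stdD_mem ψ p))⟩
  have hdm : flat (dm.map (DD ψ).subtype) =
      bigM B (fun i => ∑ p, algebraMap K (HF K) (z (i, p)) • stdD ψ p) := by
    ext1 a b
    change (∑ i, algebraMap K (HF K) (B i a.1 b.1) •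
      ∑ p, algebraMap K (HF K) (z (i, p)) • stdD ψ p) a.2 b.2 = _
    rw [Matrix.sum_apply]
    rfl
  have hdvd := @dvd_rank_of_division (HF K) (ZMod l) m n (DD ψ) _ _ _ _ _ _ _ (DDdiv ψ hψ)
    (DD ψ).subtype dm
  rw [hdm, ZMod.card] at hdvd
  rwa [le_antisymm (hup _) hz] at hdvd


/-- The blow-up of a tuple of linear maps along a tuple of square matrices. -/
noncomputable def bigL {K V W ι Λ : Type} [Field K] [AddCommGroup V] [Module K V] [AddCommGroup W]
    [Module K W] [Fintype ι] [Fintype Λ] (B : ι → V →ₗ[K] W) (x : ι → Matrix Λ Λ K) :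
    (Λ → V) →ₗ[K] (Λ → W) :=
  LinearMap.pi fun p => ∑ i, ∑ q, x i p q • (B i ∘ₗ LinearMap.proj q)

lemma bigL_apply {K V W ι Λ : Type} [Field K] [AddCommGroup V] [Module K V] [AddCommGroup W]
    [Module K W] [Fintype ι] [Fintype Λ] (B : ι → V →ₗ[K] W) (x : ι → Matrix Λ Λ K)
    (v : Λ → V) (p : Λ) : bigL B x v p = ∑ i, ∑ q, x i p q • B i (v q) := by
  simp [bigL, LinearMap.sum_apply]

lemma finrank_range_conj {K V V' W W' : Type} [Field K] [AddCommGroup V] [Module K V]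
    [AddCommGroup W] [Module K W] [AddCommGroup V'] [Module K V'] [AddCommGroup W'] [Module K W']
    (eV : V' ≃ₗ[K] V) (eW : W' ≃ₗ[K] W) (f : V →ₗ[K] W) (g : V' →ₗ[K] W')
    (h : ∀ v, f (eV v) = eW (g v)) :
    Module.finrank K (LinearMap.range f) = Module.finrank K (LinearMap.range g) := by
  have h1 : LinearMap.range f = (LinearMap.range g).map (eW : W' →ₗ[K] W) := by
    ext w
    constructor
    · rintro ⟨v, rfl⟩
      refine ⟨g (eV.symm v), ⟨_, rfl⟩, ?_⟩
      rw [LinearEquiv.coe_coe, ← h, LinearEquiv.apply_symm_apply]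
    · rintro ⟨_, ⟨v, rfl⟩, rfl⟩
      exact ⟨eV v, h v⟩
  rw [h1]
  exact LinearEquiv.finrank_map_eq eW _

lemma finrank_bigL_eq {K V W ι Λ m n : Type} [Field K] [AddCommGroup V] [Module K V]
    [AddCommGroup W] [Module K W] [Fintype ι] [Fintype Λ] [Fintype m] [Fintype n] [DecidableEq n]
    (b : Module.Basis n K V) (c : Module.Basis m K W)
    (B : ι → V →ₗ[K] W) (x : ι → Matrix Λ Λ K) :
    Module.finrank K (LinearMap.range (bigL B x)) =
      (bigM (fun i => LinearMap.toMatrix b c (B i)) x).rank := by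
  let eV : (n × Λ → K) ≃ₗ[K] (Λ → V) :=
    (LinearEquiv.funCongrLeft K K (Equiv.prodComm Λ n)).trans
      ((LinearEquiv.curry K K Λ n).trans (LinearEquiv.piCongrRight fun _ => b.equivFun.symm))
  let eW : (m × Λ → K) ≃ₗ[K] (Λ → W) :=
    (LinearEquiv.funCongrLeft K K (Equiv.prodComm Λ m)).trans
      ((LinearEquiv.curry K K Λ m).trans (LinearEquiv.piCongrRight fun _ => c.equivFun.symm))
  have heV : ∀ f q, eV f q = b.equivFun.symm (fun d => f (d, q)) := fun f q => rfl
  have heW : ∀ f q, eW f q = c.equivFun.symm (fun d => f (d, q)) := fun f q => rfl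
  refine finrank_range_conj eV eW _ (bigM (fun i => LinearMap.toMatrix b c (B i)) x).mulVecLin ?_
  intro f
  ext1 p
  rw [heW, bigL_apply]
  apply c.equivFun.injective
  rw [LinearEquiv.apply_symm_apply]
  ext1 a
  have h1 : ∀ i q, c.equivFun (B i (eV f q)) a =
      ∑ d, LinearMap.toMatrix b c (B i) a d * f (d, q) := by
    intro i q
    have := LinearMap.toMatrix_mulVec_repr b c (B i) (eV f q)
    have h2 := congrFun this a
    rw [Module.Basis.equivFun_apply, ← h2, Matrix.mulVec, dotProduct]
    apply Finset.sum_congr rfl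
    intro d _
    congr 1
    rw [← Module.Basis.equivFun_apply, heV, LinearEquiv.apply_symm_apply]
  simp only [map_sum, map_smul, Finset.sum_apply, Pi.smul_apply, h1, smul_eq_mul,
    Matrix.mulVecLin_apply, Matrix.mulVec, dotProduct, bigM, Fintype.sum_prod_type,
    Algebra.algebraMap_self, RingHom.id_apply, Finset.sum_mul, Finset.mul_sum]
  rw [Finset.sum_comm]
  rw [Finset.sum_comm (s := Finset.univ) (t := (Finset.univ : Finset Λ))]
  apply Finset.sum_congr rfl
  intro q _
  rw [Finset.sum_comm]
  apply Finset.sum_congr rfl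
  intro d _
  apply Finset.sum_congr rfl
  intro i _
  ring

lemma finrank_bigL_reindex {K V W ι Λ Λ' : Type} [Field K] [AddCommGroup V] [Module K V]
    [AddCommGroup W] [Module K W] [Fintype ι] [Fintype Λ] [Fintype Λ'] (e : Λ' ≃ Λ)
    (B : ι → V →ₗ[K] W) (x : ι → Matrix Λ Λ K) :
    Module.finrank K (LinearMap.range (bigL B fun i => (x i).submatrix e e)) =
    Module.finrank K (LinearMap.range (bigL B x)) := by
  refine finrank_range_conj (LinearEquiv.funCongrLeft K V e) (LinearEquiv.funCongrLeft K W e) _ _ ?_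
  intro v
  ext1 p
  rw [bigL_apply]
  change _ = bigL B x v (e p)
  rw [bigL_apply]
  apply Finset.sum_congr rfl
  intro i _
  exact Equiv.sum_comp e (fun q => x i (e p) q • B i (v q))

lemma regularityL {K V W ι Λ : Type} [Field K] [IsAlgClosed K] [AddCommGroup V] [Module K V]
    [AddCommGroup W] [Module K W] [FiniteDimensional K V] [FiniteDimensional K W]
    [Fintype ι] [Fintype Λ] (hΛ : (Fintype.card Λ : K) ≠ 0)
    (B : ι → V →ₗ[K] W) (x : ι → Matrix Λ Λ K)
    (hx : ∀ x' : ι → Matrix Λ Λ K, Module.finrank K (LinearMap.range (bigL B x')) ≤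
      Module.finrank K (LinearMap.range (bigL B x))) :
    Fintype.card Λ ∣ Module.finrank K (LinearMap.range (bigL B x)) := by
  have : NeZero (Fintype.card Λ) := ⟨fun h => hΛ (by rw [h]; simp)⟩
  have e : ZMod (Fintype.card Λ) ≃ Λ := Fintype.equivOfCardEq (ZMod.card _)
  have b := Module.finBasis K V
  have c := Module.finBasis K W
  rw [← finrank_bigL_reindex e, finrank_bigL_eq b c]
  apply regularity _ _ hΛ
  intro x'
  rw [← finrank_bigL_eq, ← finrank_bigL_eq, finrank_bigL_reindex e]
  refine le_trans (le_of_eq ?_) (hx (fun i => (x' i).submatrix e.symm e.symm))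
  have h : (fun i => ((x' i).submatrix e.symm e.symm).submatrix e e) = x' := by
    funext i
    ext1 a b
    simp
  rw [← finrank_bigL_reindex e, h]

lemma exists_max_bigL {K V W ι Λ : Type} [Field K] [AddCommGroup V] [Module K V]
    [AddCommGroup W] [Module K W] [FiniteDimensional K W]
    [Fintype ι] [Fintype Λ] (B : ι → V →ₗ[K] W) :
    ∃ x : ι → Matrix Λ Λ K, ∀ x' : ι → Matrix Λ Λ K,
      Module.finrank K (LinearMap.range (bigL B x')) ≤
      Module.finrank K (LinearMap.range (bigL B x)) := by
  let S : Set ℕ := Set.range fun x : ι → Matrix Λ Λ K =>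
    Module.finrank K (LinearMap.range (bigL B x))
  have hb : BddAbove S := ⟨Module.finrank K (Λ → W), by
    rintro _ ⟨x, rfl⟩
    exact Submodule.finrank_le _⟩
  obtain ⟨x, hx⟩ := Nat.sSup_mem (s := S) ⟨_, ⟨0, rfl⟩⟩ hb
  exact ⟨x, fun x' => (le_csSup hb ⟨x', rfl⟩).trans hx.ge⟩

lemma exists_optimal {K V W ι : Type} [Field K] [IsAlgClosed K] [AddCommGroup V] [Module K V]
    [AddCommGroup W] [Module K W] [FiniteDimensional K V] [FiniteDimensional K W]
    [Fintype ι] (B : ι → V →ₗ[K] W) :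
    ∃ (l : ℕ) (x : ι → Matrix (Fin l) (Fin l) K), 0 < l ∧ ∀ N : ℕ, (N : K) ≠ 0 →
      ∀ z : ι → Matrix (Fin N × Fin l) (Fin N × Fin l) K,
        Module.finrank K (LinearMap.range (bigL B z)) ≤
          N * Module.finrank K (LinearMap.range (bigL B x)) := by
  let S : Set ℕ := {d | ∃ (l : ℕ) (x : ι → Matrix (Fin l) (Fin l) K), (l : K) ≠ 0 ∧
    Module.finrank K (LinearMap.range (bigL B x)) = l * d}
  have hmax : ∀ l : ℕ, (l : K) ≠ 0 → ∃ d ∈ S, ∀ x : ι → Matrix (Fin l) (Fin l) K,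
      Module.finrank K (LinearMap.range (bigL B x)) ≤ l * d := by
    intro l hl
    obtain ⟨x, hx⟩ := exists_max_bigL (Λ := Fin l) B
    obtain ⟨d, hd⟩ := regularityL (by simpa using hl) B x hx
    rw [Fintype.card_fin] at hd
    exact ⟨d, ⟨l, x, hl, hd⟩, fun x' => hd ▸ hx x'⟩
  have hb : BddAbove S := ⟨Module.finrank K W, by
    rintro d ⟨l, x, hl, h⟩
    have h1 : Module.finrank K (LinearMap.range (bigL B x)) ≤ _ := Submodule.finrank_le _
    rw [Module.finrank_pi_fintype, Finset.sum_const, Finset.card_univ, Fintype.card_fin,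
      smul_eq_mul, h] at h1
    refine Nat.le_of_mul_le_mul_left h1 (Nat.pos_of_ne_zero ?_)
    rintro rfl
    simp at hl⟩
  obtain ⟨d1, hd1, -⟩ := hmax 1 (by simp)
  obtain ⟨l, x, hl, h⟩ := Nat.sSup_mem (s := S) ⟨_, hd1⟩ hb
  refine ⟨l, x, Nat.pos_of_ne_zero (by rintro rfl; simp at hl), ?_⟩
  intro N hN z
  obtain ⟨d', hd', h'⟩ := hmax (N * l) (by push_cast; exact mul_ne_zero hN hl)
  rw [h, ← finrank_bigL_reindex finProdFinEquiv.symm, ← mul_assoc]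
  exact (h' _).trans (Nat.mul_le_mul_left _ (le_csSup hb hd'))


lemma sum_finrank_le_of_filtered {K W : Type} [Field K] [AddCommGroup W] [Module K W]
    [FiniteDimensional K W] {N : ℕ} (R : Submodule K (Fin N → W)) (P : Fin N → Submodule K W)
    (h : ∀ i, ∀ p ∈ P i, ∃ r ∈ R, (∀ j < i, r j = 0) ∧ r i = p) :
    ∑ i, Module.finrank K (P i) ≤ Module.finrank K R := by
  classical
  let Q : Fin N → Submodule K (Fin N → W) := fun i =>
    { carrier := {r | r ∈ R ∧ (∀ j < i, r j = 0) ∧ r i ∈ P i}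
      add_mem' := by
        rintro a b ⟨h1, h2, h3⟩ ⟨h4, h5, h6⟩
        exact ⟨R.add_mem h1 h4, fun j hj => by simp [h2 j hj, h5 j hj], (P i).add_mem h3 h6⟩
      zero_mem' := ⟨R.zero_mem, fun _ _ => rfl, (P i).zero_mem⟩
      smul_mem' := by
        rintro c a ⟨h1, h2, h3⟩
        exact ⟨R.smul_mem c h1, fun j hj => by simp [h2 j hj], (P i).smul_mem c h3⟩ }
  have hs : ∀ i, ∃ s : P i →ₗ[K] Q i, ∀ p, (s p : Fin N → W) i = p := by
    intro i
    let π : Q i →ₗ[K] P i := ((LinearMap.proj i).comp (Q i).subtype).codRestrict (P i)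
      (fun r => r.2.2.2)
    have hπ : Function.Surjective π := by
      rintro ⟨p, hp⟩
      obtain ⟨r, h1, h2, h3⟩ := h i p hp
      exact ⟨⟨r, h1, h2, h3 ▸ hp⟩, Subtype.ext h3⟩
    obtain ⟨s, hs⟩ := LinearMap.exists_rightInverse_of_surjective π (LinearMap.range_eq_top.2 hπ)
    exact ⟨s, fun p => congrArg Subtype.val (LinearMap.congr_fun hs p)⟩
  choose s hs using hs
  let Φ : (∀ i, P i) →ₗ[K] (Fin N → W) :=
    ∑ i, (Q i).subtype ∘ₗ s i ∘ₗ LinearMap.proj i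
  have hΦ : ∀ p, Φ p = ∑ i, (s i (p i) : Fin N → W) := by
    intro p
    simp [Φ, LinearMap.sum_apply]
  have hinj : Function.Injective Φ := by
    rw [← LinearMap.ker_eq_bot, LinearMap.ker_eq_bot']
    intro p hp
    rw [hΦ] at hp
    have key : ∀ n : ℕ, ∀ i : Fin N, i.val = n → p i = 0 := by
      intro n
      induction n using Nat.strong_induction_on with
      | _ n ih =>
        intro i hi
        have h1 := congrFun hp i
        rw [Finset.sum_apply, Finset.sum_eq_single i, hs] at h1
        · exact Subtype.ext h1
        · intro j _ hj
          rcases lt_or_gt_of_ne hj with hlt | hlt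
          · rw [ih j.val (by omega) j rfl]; simp
          · exact (s j (p j)).2.2.1 i hlt
        · simp
    funext i
    exact key _ i rfl
  have hR : ∀ p, Φ p ∈ R := by
    intro p
    rw [hΦ]
    exact R.sum_mem fun i _ => (s i (p i)).2.1
  have := LinearMap.finrank_le_finrank_of_injective (f := Φ.codRestrict R hR)
    (fun a b hab => hinj (congrArg Subtype.val hab))
  rwa [Module.finrank_pi_fintype] at this

lemma chain_lemma {K V W ι : Type} [Field K] [AddCommGroup V] [Module K V]
    [AddCommGroup W] [Module K W] [FiniteDimensional K V] [FiniteDimensional K W]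
    [Fintype ι] (B : ι → V →ₗ[K] W) (l : ℕ) (x : ι → Matrix (Fin l) (Fin l) K)
    (hx : ∀ N : ℕ, (N : K) ≠ 0 →
      ∀ z : ι → Matrix (Fin N × Fin l) (Fin N × Fin l) K,
        Module.finrank K (LinearMap.range (bigL B z)) ≤
          N * Module.finrank K (LinearMap.range (bigL B x)))
    (k : ℕ) (v : ℕ → Fin l → V) (y : ℕ → ι → Matrix (Fin l) (Fin l) K)
    (h0 : bigL B x (v 0) = 0) (hv : ∀ i < k, bigL B x (v (i + 1)) = bigL B (y i) (v i)) :
    bigL B (y k) (v k) ∈ LinearMap.range (bigL B x) := by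
  classical
  by_contra hw
  obtain ⟨N, hNk, hN⟩ : ∃ N : ℕ, k + 2 ≤ N ∧ (N : K) ≠ 0 := by
    by_cases h : ((k + 2 : ℕ) : K) = 0
    · refine ⟨k + 3, by omega, ?_⟩
      intro h'
      have : ((k + 3 : ℕ) : K) = ((k + 2 : ℕ) : K) + 1 := by push_cast; ring
      rw [this, h, zero_add] at h'
      exact one_ne_zero h'
    · exact ⟨k + 2, le_rfl, h⟩
  let z : ι → Matrix (Fin N × Fin l) (Fin N × Fin l) K := fun s a b =>
    (if a.1 = b.1 then x s a.2 b.2 else 0) -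
      (if a.1.val = b.1.val + 1 then y b.1.val s a.2 b.2 else 0)
  let eV : (Fin N × Fin l → V) ≃ₗ[K] (Fin N → Fin l → V) := LinearEquiv.curry K V _ _
  let eW : (Fin N × Fin l → W) ≃ₗ[K] (Fin N → Fin l → W) := LinearEquiv.curry K W _ _
  let T : (Fin N → Fin l → V) →ₗ[K] (Fin N → Fin l → W) :=
    eW.toLinearMap ∘ₗ bigL B z ∘ₗ eV.symm.toLinearMap
  have hT : ∀ u j, T u j = bigL B x (u j) -
      ∑ q : Fin N, if j.val = q.val + 1 then bigL B (y q.val) (u q) else 0 := by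
    intro u j
    ext1 a
    change bigL B z (eV.symm u) (j, a) = _
    rw [bigL_apply, Pi.sub_apply, bigL_apply, Finset.sum_apply]
    have h1 : ∀ q : Fin N, (if j.val = q.val + 1 then bigL B (y q.val) (u q) else 0) a =
        ∑ s, ∑ c, if j.val = q.val + 1 then y q.val s a c • B s (u q c) else 0 := by
      intro q
      split_ifs
      · rw [bigL_apply]
      · simp
    simp only [h1]
    rw [Finset.sum_comm (s := (Finset.univ : Finset (Fin N))) (t := (Finset.univ : Finset ι)),
      ← Finset.sum_sub_distrib]
    apply Finset.sum_congr rfl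
    intro s _
    rw [Fintype.sum_prod_type]
    have h2 : ∀ q c, z s (j, a) (q, c) • B s (eV.symm u (q, c)) =
        (if j = q then x s a c • B s (u q c) else 0) -
        (if j.val = q.val + 1 then y q.val s a c • B s (u q c) else 0) := by
      intro q c
      change ((if j = q then x s a c else 0) -
        (if j.val = q.val + 1 then y q.val s a c else 0)) • B s (u q c) = _
      rw [sub_smul, ite_smul, ite_smul, zero_smul]
    simp only [h2, Finset.sum_sub_distrib]
    congr 1
    rw [Finset.sum_eq_single j]
    · simp
    · intro q _ hq; simp [hq.symm]
    · simp
  have hrank : Module.finrank K (LinearMap.range T) =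
      Module.finrank K (LinearMap.range (bigL B z)) := by
    refine finrank_range_conj eV eW T _ ?_
    intro u
    simp [T]
  let f := bigL B x
  let w := bigL B (y k) (v k)
  let k1 : Fin N := ⟨k + 1, by omega⟩
  let P : Fin N → Submodule K (Fin l → W) := fun i =>
    if i = k1 then LinearMap.range f ⊔ Submodule.span K {w} else LinearMap.range f
  have hP1 : P k1 = LinearMap.range f ⊔ Submodule.span K {w} := if_pos rfl
  have hP2 : ∀ i, i ≠ k1 → P i = LinearMap.range f := fun i hi => if_neg hi
  have hsingle : ∀ (i : Fin N) (g : Fin l → V), (∀ j < i, T (Pi.single i g) j = 0) ∧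
      T (Pi.single i g) i = f g := by
    intro i g
    constructor
    · intro j hj
      rw [hT, Pi.single_eq_of_ne hj.ne, map_zero, zero_sub, neg_eq_zero]
      apply Finset.sum_eq_zero
      intro q _
      split_ifs with h
      · have : q ≠ i := by rintro rfl; have := Fin.lt_def.1 hj; omega
        rw [Pi.single_eq_of_ne this, map_zero]
      · rfl
    · rw [hT, Pi.single_eq_same, Finset.sum_eq_zero, sub_zero]
      intro q _
      split_ifs with h
      · have : q ≠ i := by rintro rfl; omega
        rw [Pi.single_eq_of_ne this, map_zero]
      · rfl
  let uu : Fin N → Fin l → V := fun j => if j.val ≤ k then v j.val else 0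
  have huu : (∀ j < k1, T uu j = 0) ∧ T uu k1 = - w := by
    constructor
    · rintro ⟨j, hj'⟩ hj
      have hjk : j < k + 1 := hj
      rw [hT]
      have h1 : uu ⟨j, hj'⟩ = v j := if_pos (by simpa using Nat.lt_succ_iff.1 hjk)
      rw [h1]
      cases j with
      | zero =>
        rw [h0, Finset.sum_eq_zero, sub_zero]
        intro q _
        rw [if_neg]
        simp
      | succ j =>
        rw [hv j (by omega), Finset.sum_eq_single ⟨j, by omega⟩]
        · have h2 : uu ⟨j, by omega⟩ = v j := if_pos (by simp; omega)
          rw [if_pos rfl, h2, sub_self]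
        · intro q _ hq
          rw [if_neg]
          intro h
          apply hq
          ext
          have h' : j + 1 = q.val + 1 := h
          change q.val = j
          omega
        · simp
    · rw [hT]
      have h1 : uu k1 = 0 := if_neg (by simp [k1])
      rw [h1, map_zero, zero_sub, Finset.sum_eq_single ⟨k, by omega⟩]
      · have h2 : uu ⟨k, by omega⟩ = v k := if_pos (by simp)
        rw [if_pos rfl, h2]
      · intro q _ hq
        rw [if_neg]
        intro h
        apply hq
        ext
        simp [k1] at h
        simp
        omega
      · simp
  have hfil := sum_finrank_le_of_filtered (LinearMap.range T) P (by
    intro i p hp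
    by_cases hi : i = k1
    · subst hi
      rw [hP1] at hp
      obtain ⟨_, ⟨g, rfl⟩, t, ht, rfl⟩ := Submodule.mem_sup.1 hp
      obtain ⟨c, rfl⟩ := Submodule.mem_span_singleton.1 ht
      refine ⟨T (Pi.single k1 g - c • uu), ⟨_, rfl⟩, ?_, ?_⟩
      · intro j hj
        rw [map_sub, map_smul, Pi.sub_apply, Pi.smul_apply, (hsingle k1 g).1 j hj, huu.1 j hj]
        simp
      · rw [map_sub, map_smul, Pi.sub_apply, Pi.smul_apply, (hsingle k1 g).2, huu.2]
        simp
    · rw [hP2 i hi] at hp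
      obtain ⟨g, rfl⟩ := hp
      exact ⟨T (Pi.single i g), ⟨_, rfl⟩, (hsingle i g).1, (hsingle i g).2⟩)
  have h1 : Module.finrank K (LinearMap.range f) < Module.finrank K (P k1) := by
    rw [hP1]
    apply Submodule.finrank_lt_finrank_of_lt
    rw [lt_iff_le_and_ne]
    refine ⟨le_sup_left, fun h => hw ?_⟩
    change w ∈ LinearMap.range f
    rw [h]
    exact Submodule.mem_sup_right (Submodule.mem_span_singleton_self w)
  have h2 : N * Module.finrank K (LinearMap.range f) < ∑ i, Module.finrank K (P i) := by
    calc N * Module.finrank K (LinearMap.range f)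
        = ∑ i : Fin N, Module.finrank K (LinearMap.range f) := by simp
      _ < _ := by
        apply Finset.sum_lt_sum
        · intro i _
          by_cases hi : i = k1
          · rw [hi]; exact h1.le
          · rw [hP2 i hi]
        · exact ⟨k1, Finset.mem_univ _, h1⟩
  have h3 := hx N hN z
  rw [hrank] at hfil
  exact absurd (h2.trans_le (hfil.trans h3)) (lt_irrefl _)

/-- Main linear algebra theorem: a compression-type condition implies that some blow-up is
surjective. -/
theorem la_main {K V W ι : Type} [Field K] [IsAlgClosed K] [AddCommGroup V] [Module K V]
    [AddCommGroup W] [Module K W] [FiniteDimensional K V] [FiniteDimensional K W]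
    [Fintype ι] (B : ι → V →ₗ[K] W)
    (hB : ∀ U : Submodule K V, Module.finrank K U + Module.finrank K W ≤
      Module.finrank K V + Module.finrank K (⨆ i, U.map (B i) : Submodule K W)) :
    ∃ (l : ℕ) (x : ι → Matrix (Fin l) (Fin l) K), 0 < l ∧ Function.Surjective (bigL B x) := by
  classical
  obtain ⟨l, x, hl, hx⟩ := exists_optimal B
  refine ⟨l, x, hl, ?_⟩
  let Chain : ℕ → (ℕ → Fin l → V) → (ℕ → ι → Matrix (Fin l) (Fin l) K) → Prop := fun k v y =>
    bigL B x (v 0) = 0 ∧ ∀ i < k, bigL B x (v (i + 1)) = bigL B (y i) (v i)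
  let Reach : (Fin l → V) → Prop := fun u => ∃ k v y, Chain k v y ∧ v k = u
  have hker : ∀ u, bigL B x u = 0 → Reach u := fun u hu =>
    ⟨0, fun _ => u, 0, ⟨hu, by simp⟩, rfl⟩
  have hreach : ∀ u y, Reach u → ∃ u', Reach u' ∧ bigL B x u' = bigL B y u := by
    rintro u y' ⟨k, v, y, ⟨h0, hv⟩, rfl⟩
    obtain ⟨u', hu'⟩ := chain_lemma B l x hx k v (Function.update y k y') h0 (by
      intro i hi
      rw [Function.update_of_ne hi.ne]
      exact hv i hi)
    rw [Function.update_self] at hu'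
    refine ⟨u', ⟨k + 1, Function.update v (k + 1) u', Function.update y k y', ⟨?_, ?_⟩, ?_⟩, hu'⟩
    · rw [Function.update_of_ne (by omega)]; exact h0
    · intro i hi
      rw [Function.update_of_ne (a := i) (a' := k + 1) (by omega)]
      by_cases hik : i = k
      · subst hik
        rw [Function.update_self, Function.update_self, hu']
      · rw [Function.update_of_ne (by omega), Function.update_of_ne hik]
        exact hv i (by omega)
    · rw [Function.update_self]
  let U : Submodule K V := Submodule.span K {w | ∃ u, Reach u ∧ ∃ q, u q = w}
  have hU : ∀ u, Reach u → ∀ q, u q ∈ U := fun u hu q => Submodule.subset_span ⟨u, hu, q, rfl⟩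
  let BU : Submodule K W := ⨆ i, U.map (B i)
  let incV : (Fin l → U) →ₗ[K] (Fin l → V) := LinearMap.compLeft U.subtype (Fin l)
  let incW : (Fin l → BU) →ₗ[K] (Fin l → W) := LinearMap.compLeft BU.subtype (Fin l)
  have hincV : ∀ u : Fin l → V, (∀ q, u q ∈ U) → ∃ u', incV u' = u :=
    fun u hu => ⟨fun q => ⟨u q, hu q⟩, rfl⟩
  let h := bigL B x ∘ₗ incV
  have hsub : ∀ p, BU ≤ (LinearMap.range h).comap (LinearMap.single K (fun _ => W) p) := by
    intro p
    refine iSup_le fun i => ?_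
    rw [Submodule.map_le_iff_le_comap]
    refine Submodule.span_le.2 ?_
    rintro _ ⟨u, hu, q, rfl⟩
    obtain ⟨u', hu', he⟩ := hreach u
      (fun i' => if i' = i then Matrix.single p q 1 else 0) hu
    obtain ⟨u'', rfl⟩ := hincV u' (hU u' hu')
    refine ⟨u'', ?_⟩
    change bigL B x (incV u'') = Pi.single p (B i (u q))
    rw [he]
    ext1 a
    rw [bigL_apply, Finset.sum_eq_single i, Finset.sum_eq_single q]
    · by_cases ha : a = p
      · subst ha; simp
      · simp [ha, Matrix.single_apply, Ne.symm ha]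
    · intro c _ hc; simp [Matrix.single_apply, hc.symm]
    · simp
    · intro j _ hj; simp [hj]
    · simp
  have hr : LinearMap.range incW ≤ LinearMap.range h := by
    rintro _ ⟨w, rfl⟩
    have : incW w = ∑ p, LinearMap.single K (fun _ => W) p (w p) := by
      ext1 a
      simp [incW, Finset.sum_apply, Pi.single_apply]
    rw [this]
    exact Submodule.sum_mem _ fun p _ => hsub p (w p).2
  have hk : LinearMap.ker (bigL B x) ≤ (LinearMap.ker h).map incV := by
    intro u hu
    obtain ⟨u', rfl⟩ := hincV u (hU u (hker u hu))
    exact ⟨u', hu, rfl⟩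
  have e1 : l * Module.finrank K BU ≤ Module.finrank K (LinearMap.range h) := by
    refine le_trans (le_of_eq ?_) (Submodule.finrank_mono hr)
    rw [LinearMap.finrank_range_of_inj]
    · rw [Module.finrank_pi_fintype]; simp
    · intro a b hab
      funext p
      exact Subtype.ext (congrFun hab p)
  have e2 : Module.finrank K (LinearMap.ker (bigL B x)) ≤ Module.finrank K (LinearMap.ker h) :=
    (Submodule.finrank_mono hk).trans (Submodule.finrank_map_le _ _)
  have e3 := LinearMap.finrank_range_add_finrank_ker h
  have e4 := LinearMap.finrank_range_add_finrank_ker (bigL B x)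
  rw [Module.finrank_pi_fintype, Finset.sum_const, Finset.card_univ, Fintype.card_fin,
    smul_eq_mul] at e3 e4
  have e5 : l * (Module.finrank K U + Module.finrank K W) ≤ l * (Module.finrank K V +
      Module.finrank K BU) := Nat.mul_le_mul_left _ (hB U)
  rw [mul_add, mul_add] at e5
  rw [← LinearMap.range_eq_top]
  apply Submodule.eq_top_of_finrank_eq
  apply le_antisymm (Submodule.finrank_le _)
  rw [Module.finrank_pi_fintype, Finset.sum_const, Finset.card_univ, Fintype.card_fin,
    smul_eq_mul]
  omega


lemma sep_simples {A : Type} [Ring A] {K : Type} [Field K] [Algebra K A] [FiniteDimensional K A]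
    {ι : Type} [Fintype ι] [DecidableEq ι] (S : ι → ModuleCat.{0} A)
    (hS : ∀ i, IsSimpleModule A (S i)) (hne : ∀ i j, i ≠ j → IsEmpty (S i ≃ₗ[A] S j)) (s : ι) :
    ∃ a : A, ∀ t (x : S t), a • x = if t = s then x else 0 := by
  have hss : IsSemisimpleModule A (∀ i, S i) := inferInstance
  let f : Module.End (Module.End A (∀ i, S i)) (∀ i, S i) :=
    { toFun := fun v => Pi.single s (v s)
      map_add' := by intro v w; rw [← Pi.single_add]; rfl
      map_smul' := by
        intro g v
        change Pi.single s (g v s) = g (Pi.single s (v s))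
        have h0 : ∀ i j, i ≠ j → ∀ x : S i, g (Pi.single i x) j = 0 := by
          intro i j hij x
          have h1 := LinearMap.bijective_or_eq_zero
            ((LinearMap.proj j : (∀ i, S i) →ₗ[A] S j) ∘ₗ g ∘ₗ LinearMap.single A (fun i => S i) i)
          rcases h1 with h1 | h1
          · exact ((hne i j hij).false (LinearEquiv.ofBijective _ h1)).elim
          · exact LinearMap.congr_fun h1 x
        funext j
        by_cases hj : j = s
        · subst hj
          rw [Pi.single_eq_same]
          have hv : v = ∑ i, Pi.single i (v i) := (Finset.univ_sum_single v).symm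
          conv_lhs => rw [hv]
          rw [map_sum, Finset.sum_apply, Finset.sum_eq_single j]
          · intro b _ hb
            exact h0 b j hb _
          · simp
        · rw [Pi.single_eq_of_ne hj, h0 s j (Ne.symm hj)] }
  let _ : ∀ i, Module K (S i) := fun i => Module.compHom (S i) (algebraMap K A)
  have : ∀ i, IsScalarTower K A (S i) := fun i => ⟨fun k a x => by
    change (k • a) • x = (algebraMap K A k) • (a • x)
    rw [Algebra.smul_def, mul_smul]⟩
  have : ∀ i, Module.Finite A (S i) := fun i => inferInstance
  have : ∀ i, Module.Finite K (S i) := fun i => Module.Finite.trans A (S i)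
  have hfin : Module.Finite K (∀ i, S i) := inferInstance
  obtain ⟨F, hF⟩ := hfin.fg_top
  obtain ⟨a, ha⟩ := jacobson_density f F
  refine ⟨a, ?_⟩
  have hall : ∀ m : (∀ i, S i), Pi.single s (m s) = a • m := by
    intro m
    have hm : m ∈ Submodule.span K (F : Set (∀ i, S i)) := by rw [hF]; trivial
    induction hm using Submodule.span_induction with
    | mem m hm => exact ha m hm
    | zero => simp
    | add x y _ _ hx hy => rw [smul_add, ← hx, ← hy, ← Pi.single_add]; rfl
    | smul k x _ hx =>
      rw [smul_comm, ← hx, ← Pi.single_smul]; rfl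
  intro t x
  have := congrFun (hall (Pi.single t x)) t
  rw [Pi.smul_apply, Pi.single_eq_same] at this
  rw [← this]
  split_ifs with h
  · subst h; simp
  · rw [Pi.single_eq_of_ne h]

/-- There are finitely many simple modules. -/
lemma exists_simples (A : Type) [Ring A] (K : Type) [Field K] [Algebra K A]
    [FiniteDimensional K A] :
    ∃ (n : ℕ) (S : Fin n → ModuleCat.{0} A), (∀ i, IsSimpleModule A (S i)) ∧
      (∀ i j, i ≠ j → IsEmpty (S i ≃ₗ[A] S j)) ∧
      ∀ L : ModuleCat.{0} A, IsSimpleModule A L → ∃ i, Nonempty (L ≃ₗ[A] S i) := by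
  classical
  let P : ℕ → Prop := fun n => ∃ S : Fin n → ModuleCat.{0} A, (∀ i, IsSimpleModule A (S i)) ∧
      (∀ i j, i ≠ j → IsEmpty (S i ≃ₗ[A] S j))
  have hb : ∀ n, P n → n ≤ Module.finrank K A := by
    rintro n ⟨S, hS, hne⟩
    choose a ha using sep_simples (K := K) S hS hne
    have hli : LinearIndependent K a := by
      rw [Fintype.linearIndependent_iff]
      intro g hg i
      have := hS i
      have := IsSimpleModule.nontrivial A (S i)
      obtain ⟨x, hx⟩ := exists_ne (0 : S i)
      have h1 : (∑ j, g j • a j) • x = 0 := by rw [hg, zero_smul]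
      rw [Finset.sum_smul, Finset.sum_eq_single i] at h1
      · by_contra hgi
        apply hx
        have h2 : (g i • a i) • x = (algebraMap K A (g i)) • x := by
          rw [Algebra.smul_def, mul_smul, ha, if_pos rfl]
        rw [h2] at h1
        have h3 : (algebraMap K A (g i)⁻¹) • (algebraMap K A (g i)) • x = x := by
          rw [← mul_smul, ← map_mul, inv_mul_cancel₀ hgi, map_one, one_smul]
        rw [← h3, h1, smul_zero]
      · intro j _ hj
        rw [Algebra.smul_def, mul_smul, ha, if_neg (Ne.symm hj), smul_zero]
      · simp
    have := hli.fintype_card_le_finrank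
    rwa [Fintype.card_fin] at this
  have h0 : P 0 := ⟨Fin.elim0, fun i => i.elim0, fun i => i.elim0⟩
  let n := Nat.findGreatest P (Module.finrank K A)
  obtain ⟨S, hS, hne⟩ : P n := Nat.findGreatest_spec (Nat.zero_le _) h0
  refine ⟨n, S, hS, hne, ?_⟩
  intro L hL
  by_contra hcon
  push Not at hcon
  have hP : P (n + 1) := by
    refine ⟨Fin.cons L S, ?_, ?_⟩
    · intro i
      refine Fin.cases ?_ (fun i => ?_) i
      · exact hL
      · exact hS i
    · intro i j
      refine Fin.cases ?_ (fun i => ?_) i <;> refine Fin.cases ?_ (fun j => ?_) j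
      · intro h; exact absurd rfl h
      · intro _; exact (hcon j)
      · intro _; exact ⟨fun e => (hcon i).false e.symm⟩
      · intro h; exact hne i j (fun h' => h (by rw [h']))
  have := Nat.le_findGreatest (hb _ hP) hP
  change n + 1 ≤ n at this
  omega

lemma exists_idempotents (A : Type) [Ring A] (K : Type) [Field K] [Algebra K A]
    [FiniteDimensional K A] :
    ∃ (n : ℕ) (S : Fin n → ModuleCat.{0} A) (e : Fin n → A), (∀ i, IsSimpleModule A (S i)) ∧
      (∀ L : ModuleCat.{0} A, IsSimpleModule A L → ∃ i, Nonempty (L ≃ₗ[A] S i)) ∧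
      (∀ i, IsIdempotentElem (e i)) ∧
      ∀ s t (x : S t), e s • x = if t = s then x else 0 := by
  obtain ⟨n, S, hS, hne, hall⟩ := exists_simples A K
  have : IsArtinianRing A := IsArtinianRing.of_finite K A
  have key : ∀ s, ∃ e : A, IsIdempotentElem e ∧ ∀ t (x : S t), e • x = if t = s then x else 0 := by
    intro s
    obtain ⟨a, ha⟩ := sep_simples (K := K) S hS hne s
    have hnil : IsNilpotent (Ring.jacobson A) := IsSemiprimaryRing.isNilpotent
    obtain ⟨N, hN⟩ := hnil
    have hidem : a * a - a ∈ Ring.jacobson A := by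
      rw [Ring.jacobson_eq_sInf_isMaximal, Submodule.mem_sInf]
      intro m hm
      have hm' : IsSimpleModule A (A ⧸ m) := isSimpleModule_iff_isCoatom.2 hm.out.out
      obtain ⟨i, ⟨φ⟩⟩ := hall (ModuleCat.of A (A ⧸ m)) hm'
      rw [← Submodule.Quotient.mk_eq_zero m]
      apply φ.injective
      have : (Submodule.Quotient.mk (a * a - a) : A ⧸ m) =
          (a * a - a) • (Submodule.Quotient.mk 1 : A ⧸ m) := by
        rw [← Submodule.Quotient.mk_smul, smul_eq_mul, mul_one]
      rw [map_zero, this]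
      refine (φ.map_smul (a * a - a) (Submodule.Quotient.mk 1)).trans ?_
      rw [sub_smul, mul_smul, ha, ha]
      split_ifs <;> simp
    obtain ⟨e, he, hea⟩ := exists_isIdempotentElem_eq_of_ker_isNilpotent
      (Ideal.Quotient.mk (Ring.jacobson A)) (by
        intro x hx
        rw [Ideal.mk_ker] at hx
        refine ⟨N, ?_⟩
        have := Ideal.pow_mem_pow hx N
        rw [hN] at this
        exact this) (Ideal.Quotient.mk _ a) ⟨a, rfl⟩ (by
        rw [IsIdempotentElem, ← map_mul, Ideal.Quotient.eq]
        exact hidem)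
    refine ⟨e, he, fun t x => ?_⟩
    rw [← ha t x]
    have h1 := IsSemisimpleModule.jacobson_le_annihilator A (S t) (Ideal.Quotient.eq.1 hea)
    have h2 := Module.mem_annihilator.1 h1 x
    rwa [sub_smul, sub_eq_zero] at h2
  choose e he using key
  exact ⟨n, S, e, hS, hall, fun i => (he i).1, fun s t x => (he s).2 t x⟩


/-- The subspace `e X` for an idempotent `e`. -/
def eSub {A : Type} [Ring A] (K : Type) [Field K] [Algebra K A] (e : A) (X : Type)
    [AddCommGroup X] [Module A X] [Module K X] [IsScalarTower K A X] : Submodule K X where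
  carrier := {x | e • x = x}
  add_mem' := by
    intro a b ha hb
    simp only [Set.mem_ofPred_eq] at *
    rw [smul_add, ha, hb]
  zero_mem' := smul_zero _
  smul_mem' := by
    intro k x hx
    simp only [Set.mem_ofPred_eq] at *
    rw [smul_comm, hx]

lemma mem_eSub {A : Type} [Ring A] {K : Type} [Field K] [Algebra K A] {e : A} {X : Type}
    [AddCommGroup X] [Module A X] [Module K X] [IsScalarTower K A X] {x : X} :
    x ∈ eSub K e X ↔ e • x = x := Iff.rfl

lemma finrank_eSub_add {A : Type} [Ring A] {K : Type} [Field K] [Algebra K A] {e : A}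
    (he : IsIdempotentElem e) {X : Type}
    [AddCommGroup X] [Module A X] [Module K X] [IsScalarTower K A X] [FiniteDimensional K X]
    (L : Submodule A X) :
    Module.finrank K (eSub K e X) =
      Module.finrank K (eSub K e L) + Module.finrank K (eSub K e (X ⧸ L)) := by
  let g : eSub K e X →ₗ[K] eSub K e (X ⧸ L) :=
    ((L.mkQ.restrictScalars K) ∘ₗ (eSub K e X).subtype).codRestrict _ (by
      rintro ⟨x, hx⟩
      rw [mem_eSub] at hx ⊢
      change e • L.mkQ x = L.mkQ x
      rw [← map_smul, hx])
  have hg : Function.Surjective g := by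
    rintro ⟨y, hy⟩
    obtain ⟨x, rfl⟩ := L.mkQ_surjective y
    rw [mem_eSub] at hy
    refine ⟨⟨e • x, ?_⟩, ?_⟩
    · rw [mem_eSub, ← mul_smul, he.eq]
    · apply Subtype.ext
      change L.mkQ (e • x) = L.mkQ x
      rw [map_smul, hy]
  let h : eSub K e L →ₗ[K] eSub K e X :=
    ((L.subtype.restrictScalars K) ∘ₗ (eSub K e L).subtype).codRestrict _ (by
      rintro ⟨x, hx⟩
      exact congrArg Subtype.val hx)
  have hh : Function.Injective h := by
    intro a b hab
    apply Subtype.ext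
    apply Subtype.ext
    have h1 : (h a).1 = (h b).1 := by rw [hab]
    exact h1
  have hex : LinearMap.range h = LinearMap.ker g := by
    ext x
    constructor
    · rintro ⟨y, rfl⟩
      rw [LinearMap.mem_ker]
      apply Subtype.ext
      exact (Submodule.Quotient.mk_eq_zero L).2 y.1.2
    · intro hx
      rw [LinearMap.mem_ker] at hx
      have h1 : x.1 ∈ L := (Submodule.Quotient.mk_eq_zero L).1 (congrArg Subtype.val hx)
      exact ⟨⟨⟨x.1, h1⟩, Subtype.ext x.2⟩, rfl⟩
  have e1 := LinearMap.finrank_range_add_finrank_ker g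
  rw [← hex, LinearMap.finrank_range_of_inj hh, LinearMap.range_eq_top.2 hg, finrank_top] at e1
  omega

lemma finrank_eSub_equiv {A : Type} [Ring A] {K : Type} [Field K] [Algebra K A] {e : A}
    {X Y : Type}
    [AddCommGroup X] [Module A X] [Module K X] [IsScalarTower K A X]
    [AddCommGroup Y] [Module A Y] [Module K Y] [IsScalarTower K A Y] (φ : X ≃ₗ[A] Y) :
    Module.finrank K (eSub K e X) = Module.finrank K (eSub K e Y) := by
  have h : eSub K e Y = (eSub K e X).map (φ.restrictScalars K : X →ₗ[K] Y) := by
    ext y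
    constructor
    · intro hy
      refine ⟨φ.symm y, ?_, φ.apply_symm_apply y⟩
      change e • φ.symm y = φ.symm y
      rw [← map_smul, hy]
    · rintro ⟨x, hx, rfl⟩
      change e • φ x = φ x
      rw [← map_smul, hx]
  rw [h]
  exact (LinearEquiv.finrank_map_eq (φ.restrictScalars K) _).symm

lemma theta_zero {A : Type} [Ring A] {θ : ModuleCat.{0} A → ℝ} (hθ : IsStability A θ)
    (X : ModuleCat.{0} A) [Subsingleton X] : θ X = 0 := by
  have := hθ X X X inferInstance inferInstance inferInstance 0 0
    (Function.injective_of_subsingleton _) (Function.surjective_to_subsingleton _)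
    (Subsingleton.elim _ _)
  linarith

lemma theta_iso {A : Type} [Ring A] {θ : ModuleCat.{0} A → ℝ} (hθ : IsStability A θ)
    (X Y : ModuleCat.{0} A) (hX : Module.Finite A X) (φ : X ≃ₗ[A] Y) : θ X = θ Y := by
  have h0 := theta_zero hθ (ModuleCat.of A PUnit)
  have := hθ X Y (ModuleCat.of A PUnit) hX (Module.Finite.equiv φ) inferInstance
    φ.toLinearMap 0 φ.injective (fun y => ⟨0, Subsingleton.elim _ _⟩) (by
      rw [LinearMap.ker_zero]; exact LinearMap.range_eq_top.2 φ.surjective)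
  linarith

lemma theta_formula_aux {A : Type} [Ring A] (K : Type) [Field K] [Algebra K A]
    [FiniteDimensional K A] (θ : ModuleCat.{0} A → ℝ) (hθ : IsStability A θ)
    (hint : ∀ M : ModuleCat.{0} A, Module.Finite A M → ∃ k : ℤ, θ M = (k : ℝ)) :
    ∃ (r : ℕ) (e : Fin r → A) (n : Fin r → ℤ) (c : ℕ), 0 < c ∧
      (∀ s, IsIdempotentElem (e s)) ∧
      ∀ (X : Type) [AddCommGroup X] [Module A X] [Module K X] [IsScalarTower K A X]
        [Module.Finite A X], (c : ℝ) * θ (ModuleCat.of A X) =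
          ∑ s, (n s : ℝ) * (Module.finrank K (eSub K (e s) X) : ℝ) := by
  classical
  obtain ⟨r, S, e, hS, hall, he, hact⟩ := exists_idempotents A K
  let _ : ∀ i, Module K (S i) := fun i => Module.compHom (S i) (algebraMap K A)
  have _ : ∀ i, IsScalarTower K A (S i) := fun i => ⟨fun k a x => by
    change (k • a) • x = (algebraMap K A k) • (a • x)
    rw [Algebra.smul_def, mul_smul]⟩
  have _ : ∀ i, Module.Finite A (S i) := fun i => inferInstance
  have _ : ∀ i, Module.Finite K (S i) := fun i => Module.Finite.trans A (S i)
  let d : Fin r → ℕ := fun i => Module.finrank K (S i)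
  have hd : ∀ i, 0 < d i := fun i => by
    have := IsSimpleModule.nontrivial A (S i)
    exact Module.finrank_pos
  choose k hk using fun i => hint (S i) inferInstance
  refine ⟨r, e, fun s => k s * ∏ t ∈ Finset.univ.erase s, (d t : ℤ), ∏ t, d t,
    Finset.prod_pos fun i _ => hd i, he, ?_⟩
  have hsimple : ∀ s t, Module.finrank K (eSub K (e s) (S t)) = if t = s then d s else 0 := by
    intro s t
    split_ifs with h
    · subst h
      have : eSub K (e t) (S t) = ⊤ := by
        rw [eq_top_iff]
        intro x _
        rw [mem_eSub, hact, if_pos rfl]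
      rw [this, finrank_top]
    · have : eSub K (e s) (S t) = ⊥ := by
        rw [eq_bot_iff]
        intro x hx
        rw [mem_eSub, hact, if_neg h] at hx
        exact hx.symm
      rw [this, finrank_bot]
  have main : ∀ m : ℕ, ∀ (X : Type) [AddCommGroup X] [Module A X] [Module K X]
      [IsScalarTower K A X] [Module.Finite A X], Module.finrank K X = m →
      ((∏ t, d t : ℕ) : ℝ) * θ (ModuleCat.of A X) =
          ∑ s, ((k s * ∏ t ∈ Finset.univ.erase s, (d t : ℤ) : ℤ) : ℝ) *
            (Module.finrank K (eSub K (e s) X) : ℝ) := by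
    intro m
    induction m using Nat.strong_induction_on with
    | _ m ih =>
      intro X _ _ _ _ _ hm
      have hfin : Module.Finite K X := Module.Finite.trans A X
      rcases subsingleton_or_nontrivial X with hX | hX
      · have : Subsingleton (ModuleCat.of A X) := hX
        rw [theta_zero hθ, mul_zero, Finset.sum_eq_zero]
        intro s _
        have h1 : Module.finrank K (eSub K (e s) X) = 0 := Module.finrank_zero_of_subsingleton
        rw [h1]; simp
      · have : IsArtinianRing A := IsArtinianRing.of_finite K A
        have : IsArtinian A X := inferInstance
        obtain ⟨L, hL⟩ := IsAtomic.exists_atom (Submodule A X)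
        have hLs : IsSimpleModule A L := isSimpleModule_iff_isAtom.2 hL
        have hLf : Module.Finite A L := inferInstance
        have hLn := IsSimpleModule.nontrivial A L
        have hfr : Module.finrank K (X ⧸ L) + Module.finrank K L = Module.finrank K X :=
          Submodule.finrank_quotient_add_finrank (L.restrictScalars K)
        have hLp : 0 < Module.finrank K L := by
          have : Module.Finite K L := Module.Finite.trans A L
          exact Module.finrank_pos
        have ih' := ih (Module.finrank K (X ⧸ L)) (by omega) (X ⧸ L) rfl
        have hadd := hθ (ModuleCat.of A L) (ModuleCat.of A X) (ModuleCat.of A (X ⧸ L)) hLf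
          inferInstance inferInstance L.subtype L.mkQ L.injective_subtype L.mkQ_surjective (by simp)
        rw [hadd, mul_add, ih']
        simp only [finrank_eSub_add (he _) L, Nat.cast_add, mul_add, Finset.sum_add_distrib]
        congr 1
        obtain ⟨i, ⟨φ⟩⟩ := hall (ModuleCat.of A L) hLs
        rw [theta_iso hθ _ (S i) hLf φ, hk]
        have h2 : ∀ s, Module.finrank K (eSub K (e s) L) = if i = s then d s else 0 := by
          intro s
          rw [← hsimple]
          exact finrank_eSub_equiv (K := K) (X := L) φ
        simp only [h2]
        rw [Finset.sum_eq_single i]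
        · rw [if_pos rfl]
          rw [← Finset.mul_prod_erase Finset.univ d (Finset.mem_univ i)]
          push_cast
          ring
        · intro s _ hs
          rw [if_neg (Ne.symm hs)]; simp
        · simp
  intro X _ _ _ _ _
  exact main _ X rfl

lemma theta_formula {A : Type} [Ring A] (K : Type) [Field K] [Algebra K A]
    [FiniteDimensional K A] (θ : ModuleCat.{0} A → ℝ) (hθ : IsStability A θ)
    (hint : ∀ M : ModuleCat.{0} A, Module.Finite A M → ∃ k : ℤ, θ M = (k : ℝ)) :
    ∃ (I J : Type) (_ : Fintype I) (_ : Fintype J) (eI : I → A) (eJ : J → A) (c : ℕ), 0 < c ∧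
      (∀ s, IsIdempotentElem (eI s)) ∧ (∀ s, IsIdempotentElem (eJ s)) ∧
      ∀ (X : Type) [AddCommGroup X] [Module A X] [Module K X] [IsScalarTower K A X]
        [Module.Finite A X], (c : ℝ) * θ (ModuleCat.of A X) =
          ((∑ i, Module.finrank K (eSub K (eI i) X) : ℕ) : ℝ) -
          ((∑ j, Module.finrank K (eSub K (eJ j) X) : ℕ) : ℝ) := by
  obtain ⟨r, e, n, c, hc, he, h⟩ := theta_formula_aux K θ hθ hint
  refine ⟨Σ s : Fin r, Fin (n s).toNat, Σ s : Fin r, Fin (-n s).toNat, inferInstance,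
    inferInstance, fun i => e i.1, fun j => e j.1, c, hc, fun i => he i.1, fun j => he j.1, ?_⟩
  intro X _ _ _ _ _
  rw [h X, Fintype.sum_sigma, Fintype.sum_sigma]
  push_cast
  rw [← Finset.sum_sub_distrib]
  apply Finset.sum_congr rfl
  intro s _
  have hs : ∀ m : ℕ, ∑ x : Fin m, ((Module.finrank K (eSub K (e s) X) : ℕ) : ℝ) =
      (m : ℝ) * (Module.finrank K (eSub K (e s) X) : ℝ) := by
    intro m; simp
  refine Eq.trans ?_ (congrArg₂ (fun a b => a - b) (hs _).symm (hs _).symm)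
  rw [← sub_mul]
  congr 1
  have : ((n s).toNat : ℤ) - ((-n s).toNat : ℤ) = n s := Int.toNat_sub_toNat_neg (n s)
  exact_mod_cast this.symm


/-- Solvability of the linear system attached to a matrix `a` on idempotent components. -/
def Surj {A : Type} [Ring A] {I J : Type} [Fintype I] (eI : I → A) (eJ : J → A)
    (a : J → I → A) (X : Type) [AddCommGroup X] [Module A X] : Prop :=
  ∀ w : J → X, (∀ j, eJ j • w j = w j) →
    ∃ v : I → X, (∀ i, eI i • v i = v i) ∧ ∀ j, ∑ i, a j i • v i = w j

lemma surj_torsion {A : Type} [Ring A] [IsNoetherianRing A]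
    {I J : Type} [Fintype I] (eI : I → A) (eJ : J → A)
    (a : J → I → A) (hI : ∀ i, IsIdempotentElem (eI i)) (hJ : ∀ j, IsIdempotentElem (eJ j))
    (ha : ∀ j i, eJ j * a j i = a j i) :
    IsTorsionClass A (fun X => Module.Finite A X ∧ Surj eI eJ a X) := by
  constructor
  · exact fun M h => h.1
  · intro M hM
    have : Subsingleton M := ⟨fun x y => by rw [hM x, hM y]⟩
    exact ⟨inferInstance, fun w _ => ⟨0, fun i => Subsingleton.elim _ _,
      fun j => Subsingleton.elim _ _⟩⟩
  · rintro M N ⟨_, hM⟩ hN ⟨f, hf⟩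
    refine ⟨hN, fun w hw => ?_⟩
    choose u hu using fun j => hf (w j)
    obtain ⟨v, hv, hvw⟩ := hM (fun j => eJ j • u j) (fun j => by rw [← mul_smul, (hJ j).eq])
    refine ⟨fun i => f (v i), fun i => by rw [← map_smul, hv], fun j => ?_⟩
    simp only [← map_smul]
    rw [← map_sum, hvw, map_smul, hu, hw]
  · rintro M hM L ⟨_, hL⟩ ⟨_, hQ⟩
    refine ⟨hM, fun w hw => ?_⟩
    obtain ⟨v', hv', hvw'⟩ := hQ (fun j => L.mkQ (w j)) (fun j => by
      refine (L.mkQ.map_smul (eJ j) (w j)).symm.trans ?_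
      rw [hw])
    choose u hu using fun i => L.mkQ_surjective (v' i)
    have hd : ∀ j, w j - ∑ i, a j i • eI i • u i ∈ L := by
      intro j
      rw [← Submodule.Quotient.mk_eq_zero L]
      change L.mkQ (w j - ∑ i, a j i • eI i • u i) = 0
      rw [map_sub, sub_eq_zero, map_sum]
      refine (hvw' j).symm.trans ?_
      apply Finset.sum_congr rfl
      intro i _
      rw [map_smul, map_smul, hu]
      exact congrArg _ (hv' i).symm
    obtain ⟨v, hv, hvw⟩ := hL (fun j => ⟨_, hd j⟩) (fun j => by
      apply Subtype.ext
      change eJ j • (w j - ∑ i, a j i • eI i • u i) = w j - ∑ i, a j i • eI i • u i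
      rw [smul_sub, hw, Finset.smul_sum]
      congr 1
      apply Finset.sum_congr rfl
      intro i _
      rw [← mul_smul, ha])
    refine ⟨fun i => (v i).1 + eI i • u i, fun i => ?_, fun j => ?_⟩
    · rw [smul_add, ← mul_smul, (hI i).eq]
      congr 1
      exact congrArg Subtype.val (hv i)
    · simp only [smul_add, Finset.sum_add_distrib]
      have h1 := congrArg L.subtype (hvw j)
      rw [map_sum] at h1
      have h2 : ∑ i, a j i • (v i).1 = w j - ∑ i, a j i • eI i • u i := h1
      rw [h2]
      simp

/-- The dual of the regular right module. -/
def DualA (A : Type) [Ring A] (K : Type) [Field K] [Algebra K A] : Type := A →ₗ[K] K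

noncomputable instance (A : Type) [Ring A] (K : Type) [Field K] [Algebra K A] :
    AddCommGroup (DualA A K) := inferInstanceAs (AddCommGroup (A →ₗ[K] K))

noncomputable instance (A : Type) [Ring A] (K : Type) [Field K] [Algebra K A] :
    Module K (DualA A K) := inferInstanceAs (Module K (A →ₗ[K] K))

instance (A : Type) [Ring A] (K : Type) [Field K] [Algebra K A] [FiniteDimensional K A] :
    Module.Finite K (DualA A K) := inferInstanceAs (Module.Finite K (A →ₗ[K] K))

/-- Evaluation. -/
def DualA.ev {A : Type} [Ring A] {K : Type} [Field K] [Algebra K A] (ψ : DualA A K) :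
    A →ₗ[K] K := ψ

lemma DualA.ext' {A : Type} [Ring A] {K : Type} [Field K] [Algebra K A] {ψ φ : DualA A K}
    (h : ∀ y, ψ.ev y = φ.ev y) : ψ = φ := LinearMap.ext h

lemma DualA.ev_add {A : Type} [Ring A] {K : Type} [Field K] [Algebra K A] (ψ φ : DualA A K)
    (y : A) : (ψ + φ).ev y = ψ.ev y + φ.ev y := rfl

lemma DualA.ev_zero {A : Type} [Ring A] {K : Type} [Field K] [Algebra K A]
    (y : A) : (0 : DualA A K).ev y = 0 := rfl

lemma DualA.ev_ksmul {A : Type} [Ring A] {K : Type} [Field K] [Algebra K A] (k : K)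
    (ψ : DualA A K) (y : A) : (k • ψ).ev y = k * ψ.ev y := rfl

noncomputable instance DualA.smulA (A : Type) [Ring A] (K : Type) [Field K] [Algebra K A] :
    SMul A (DualA A K) := ⟨fun a ψ => ψ.ev ∘ₗ LinearMap.mulRight K a⟩

lemma DualA.ev_smul {A : Type} [Ring A] {K : Type} [Field K] [Algebra K A] (a : A)
    (ψ : DualA A K) (y : A) : (a • ψ).ev y = ψ.ev (y * a) := rfl

noncomputable instance (A : Type) [Ring A] (K : Type) [Field K] [Algebra K A] :
    Module A (DualA A K) where
  one_smul ψ := DualA.ext' fun y => by rw [DualA.ev_smul, mul_one]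
  mul_smul a b ψ := DualA.ext' fun y => by simp only [DualA.ev_smul, mul_assoc]
  smul_zero a := DualA.ext' fun y => by rw [DualA.ev_smul]; rfl
  smul_add a ψ φ := DualA.ext' fun y => by simp only [DualA.ev_smul, DualA.ev_add]
  add_smul a b ψ := DualA.ext' fun y => by
    simp only [DualA.ev_smul, DualA.ev_add, mul_add, map_add]
  zero_smul ψ := DualA.ext' fun y => by
    rw [DualA.ev_smul, mul_zero, map_zero, DualA.ev_zero]

instance (A : Type) [Ring A] (K : Type) [Field K] [Algebra K A] :
    IsScalarTower K A (DualA A K) := ⟨fun k a ψ => DualA.ext' fun y => by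
  rw [DualA.ev_smul, DualA.ev_ksmul, DualA.ev_smul, mul_smul_comm, map_smul, smul_eq_mul]⟩

/-- The test module for solvability. -/
noncomputable def testMod {A : Type} [Ring A] (K : Type) [Field K] [Algebra K A] {I J : Type}
    [Fintype J] (eJ : J → A) (a : J → I → A) : Submodule A (J → DualA A K) where
  carrier := {ψ | (∀ j y, (ψ j).ev (eJ j * y) = (ψ j).ev y) ∧
    ∀ i y, ∑ j, (ψ j).ev (a j i * y) = 0}
  add_mem' := by
    rintro ψ φ ⟨h1, h2⟩ ⟨h3, h4⟩
    refine ⟨fun j y => ?_, fun i y => ?_⟩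
    · simp only [Pi.add_apply, DualA.ev_add, h1, h3]
    · simp only [Pi.add_apply, DualA.ev_add, Finset.sum_add_distrib, h2, h4, add_zero]
  zero_mem' := ⟨fun j y => rfl, fun i y => Finset.sum_eq_zero fun j _ => rfl⟩
  smul_mem' := by
    rintro b ψ ⟨h1, h2⟩
    refine ⟨fun j y => ?_, fun i y => ?_⟩
    · simp only [Pi.smul_apply, DualA.ev_smul, mul_assoc, h1]
    · simp only [Pi.smul_apply, DualA.ev_smul, mul_assoc, h2]

instance {A : Type} [Ring A] (K : Type) [Field K] [Algebra K A] [FiniteDimensional K A]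
    {I J : Type} [Fintype J] (eJ : J → A) (a : J → I → A) :
    Module.Finite A (testMod K eJ a) := by
  have : IsNoetherianRing A := IsNoetherianRing.of_finite K A
  have : Module.Finite A (DualA A K) := Module.Finite.of_restrictScalars_finite K A _
  infer_instance

lemma hom_testMod_eq_zero {A : Type} [Ring A] (K : Type) [Field K] [Algebra K A] {I J : Type}
    [Fintype I] [Fintype J] (eI : I → A) (eJ : J → A) (a : J → I → A)
    (hJ : ∀ j, IsIdempotentElem (eJ j)) {X : Type} [AddCommGroup X] [Module A X]
    (hX : Surj eI eJ a X) (h : X →ₗ[A] testMod K eJ a) : h = 0 := by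
  classical
  ext x : 1
  apply Subtype.ext
  funext j
  apply DualA.ext'
  intro y
  have hev : ∀ (b : A) (z : X) (j' : J), ((h (b • z)).1 j').ev 1 = ((h z).1 j').ev b := by
    intro b z j'
    rw [map_smul]
    change (b • (h z).1 j').ev 1 = _
    rw [DualA.ev_smul, one_mul]
  obtain ⟨v, hv, hvw⟩ := hX (Pi.single j ((eJ j * y) • x)) (fun j' => by
    by_cases hj : j' = j
    · subst hj; rw [Pi.single_eq_same, ← mul_smul, ← mul_assoc, (hJ j').eq]
    · rw [Pi.single_eq_of_ne hj, smul_zero])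
  have h1 : ∑ j', ((h ((Pi.single j ((eJ j * y) • x) : J → X) j')).1 j').ev 1 = 0 := by
    simp only [← hvw, map_sum]
    have h2 : ∀ j', ((∑ i, h (a j' i • v i) : testMod K eJ a).1 j').ev 1 =
        ∑ i, ((h (v i)).1 j').ev (a j' i) := by
      intro j'
      let E : testMod K eJ a →+ K :=
        { toFun := fun ψ => (ψ.1 j').ev 1
          map_zero' := rfl
          map_add' := fun _ _ => rfl }
      change E _ = _
      rw [map_sum]
      exact Finset.sum_congr rfl fun i _ => hev _ _ _
    simp only [h2]
    rw [Finset.sum_comm]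
    apply Finset.sum_eq_zero
    intro i _
    have := (h (v i)).2.2 i 1
    simpa only [mul_one] using this
  rw [Finset.sum_eq_single j] at h1
  · rw [Pi.single_eq_same, hev, (h x).2.1] at h1
    exact h1
  · intro j' _ hj
    rw [Pi.single_eq_of_ne hj, map_zero]; rfl
  · simp

lemma exists_hom_testMod {A : Type} [Ring A] (K : Type) [Field K] [Algebra K A] {I J : Type}
    [Fintype I] [Fintype J] (eI : I → A) (eJ : J → A) (a : J → I → A)
    (hI : ∀ i, IsIdempotentElem (eI i)) (hJ : ∀ j, IsIdempotentElem (eJ j))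
    (ha : ∀ j i, eJ j * a j i = a j i) (ha' : ∀ j i, a j i * eI i = a j i)
    {X : Type} [AddCommGroup X] [Module A X] [Module K X] [IsScalarTower K A X]
    (hX : ¬ Surj eI eJ a X) : ∃ h : X →ₗ[A] testMod K eJ a, h ≠ 0 := by
  classical
  unfold Surj at hX
  push Not at hX
  obtain ⟨w, hw, hX⟩ := hX
  let R : Submodule K (J → X) :=
    { carrier := {w | ∃ v : I → X, (∀ i, eI i • v i = v i) ∧ ∀ j, ∑ i, a j i • v i = w j}
      zero_mem' := ⟨0, by simp, by simp⟩
      add_mem' := by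
        rintro w w' ⟨v, h1, h2⟩ ⟨v', h3, h4⟩
        refine ⟨v + v', fun i => ?_, fun j => ?_⟩
        · rw [Pi.add_apply, smul_add, h1, h3]
        · simp only [Pi.add_apply, smul_add, Finset.sum_add_distrib, h2, h4]
      smul_mem' := by
        rintro k w ⟨v, h1, h2⟩
        refine ⟨k • v, fun i => ?_, fun j => ?_⟩
        · rw [Pi.smul_apply, smul_comm, h1]
        · simp only [Pi.smul_apply, smul_comm _ k, ← Finset.smul_sum, h2] }
  have hwR : w ∉ R := by
    rintro ⟨v, h1, h2⟩
    obtain ⟨j, hj⟩ := hX v h1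
    exact hj (h2 j)
  obtain ⟨F, hF, hFR⟩ := Submodule.exists_le_ker_of_notMem hwR
  let φ : J → X →ₗ[K] K := fun j => F ∘ₗ LinearMap.single K (fun _ => X) j ∘ₗ
    Algebra.lsmul K K X (eJ j)
  have hφ : ∀ j x, φ j x = F (Pi.single j (eJ j • x)) := fun j x => rfl
  let g : X → J → DualA A K := fun x j =>
    (φ j ∘ₗ ((LinearMap.toSpanSingleton A X x).restrictScalars K) : A →ₗ[K] K)
  have hg : ∀ x j y, (g x j).ev y = φ j (y • x) := fun x j y => rfl
  let h : X →ₗ[A] testMod K eJ a :=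
    { toFun := fun x => ⟨g x, by
        refine ⟨fun j y => ?_, fun i y => ?_⟩
        · rw [hg, hg, hφ, hφ, ← mul_smul, ← mul_smul, ← mul_assoc, (hJ j).eq]
        · simp only [hg, hφ]
          rw [← map_sum]
          apply hFR
          refine ⟨Pi.single i (eI i • y • x), fun i' => ?_, fun j => ?_⟩
          · by_cases hi : i' = i
            · subst hi; rw [Pi.single_eq_same, ← mul_smul, (hI i').eq]
            · rw [Pi.single_eq_of_ne hi, smul_zero]
          · rw [Finset.sum_eq_single i, Finset.sum_apply, Finset.sum_eq_single j]
            · rw [Pi.single_eq_same, Pi.single_eq_same, ← mul_smul, ← mul_smul, ← mul_smul,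
                ha', ← mul_assoc, ha]
            · intro j' _ hj'
              rw [Pi.single_eq_of_ne (Ne.symm hj')]
            · simp
            · intro i' _ hi'
              rw [Pi.single_eq_of_ne hi', smul_zero]
            · simp⟩
      map_add' := fun x x' => by
        apply Subtype.ext
        funext j
        apply DualA.ext'
        intro y
        change (g (x + x') j).ev y = (g x j).ev y + (g x' j).ev y
        rw [hg, hg, hg, smul_add, map_add]
      map_smul' := fun b x => by
        apply Subtype.ext
        funext j
        apply DualA.ext'
        intro y
        change (g (b • x) j).ev y = (g x j).ev (y * b)
        rw [hg, hg, mul_smul] }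
  refine ⟨h, fun h0 => hF ?_⟩
  have hw' : w = ∑ j, Pi.single j (w j) := (Finset.univ_sum_single w).symm
  rw [hw', map_sum]
  apply Finset.sum_eq_zero
  intro j _
  have h1 : (g (w j) j).ev 1 = 0 := by
    have : (h (w j)).1 j = 0 := by rw [h0]; rfl
    change (((h (w j)).1 j) : DualA A K).ev 1 = 0
    rw [this]; rfl
  rwa [hg, one_smul, hφ, hw] at h1

lemma rightPerp_torf (T : ModuleCat.{0} A → Prop) :
    IsTorsionFreeClass A (rightPerp A T) := by
  constructor
  · exact fun M h => h.1
  · intro M hM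
    have : Subsingleton M := ⟨fun x y => by rw [hM x, hM y]⟩
    exact ⟨inferInstance, fun X _ f => LinearMap.ext fun x => Subsingleton.elim _ _⟩
  · rintro M N ⟨_, hM⟩ hN ⟨g, hg⟩
    refine ⟨hN, fun X hX f => ?_⟩
    have := hM X hX (g ∘ₗ f)
    ext x : 1
    apply hg
    rw [LinearMap.zero_apply, map_zero]
    exact LinearMap.congr_fun this x
  · rintro M hM L ⟨_, hL⟩ ⟨_, hQ⟩
    refine ⟨hM, fun X hX f => ?_⟩
    have h1 : L.mkQ ∘ₗ f = 0 := hQ X hX (L.mkQ ∘ₗ f)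
    have h2 : ∀ x, f x ∈ L := fun x =>
      (Submodule.Quotient.mk_eq_zero L).1 (LinearMap.congr_fun h1 x)
    have h3 := hL X hX (f.codRestrict L h2)
    ext x : 1
    exact congrArg Subtype.val (LinearMap.congr_fun h3 x)

lemma surj_cocompact {A : Type} [Ring A] (K : Type) [Field K] [Algebra K A]
    [FiniteDimensional K A] {I J : Type}
    [Fintype I] [Fintype J] (eI : I → A) (eJ : J → A) (a : J → I → A)
    (hI : ∀ i, IsIdempotentElem (eI i)) (hJ : ∀ j, IsIdempotentElem (eJ j))
    (ha : ∀ j i, eJ j * a j i = a j i) (ha' : ∀ j i, a j i * eI i = a j i) :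
    IsCocompactTors A (fun X => Module.Finite A X ∧ Surj eI eJ a X) := by
  refine ⟨ModuleCat.of A (testMod K eJ a), inferInstanceAs (Module.Finite A (testMod K eJ a)), ?_⟩
  have hnoeth : IsNoetherianRing A := IsNoetherianRing.of_finite K A
  funext X
  apply propext
  constructor
  · intro hX F hF hN
    have hN' := hN _ rfl
    have main : ∀ m : ℕ, ∀ (X : Type) [AddCommGroup X] [Module A X] [Module K X]
        [IsScalarTower K A X], Module.finrank K X = m →
        rightPerp A (fun X => Module.Finite A X ∧ Surj eI eJ a X) (ModuleCat.of A X) →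
        F (ModuleCat.of A X) := by
      intro m
      induction m using Nat.strong_induction_on with
      | _ m ih =>
        intro X _ _ _ _ hm hX
        have hfA : Module.Finite A X := hX.1
        have hfin : Module.Finite K X := Module.Finite.trans A X
        by_cases hS : Surj eI eJ a X
        · apply hF.zero
          intro x
          have := hX.2 (ModuleCat.of A X) ⟨hX.1, hS⟩ LinearMap.id
          exact LinearMap.congr_fun this x
        · obtain ⟨h, hh⟩ := exists_hom_testMod K eI eJ a hI hJ ha ha' hS
          apply hF.ext (ModuleCat.of A X) hfA (LinearMap.ker h)
          · apply ih (Module.finrank K (LinearMap.ker h)) _ (LinearMap.ker h) rfl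
            · exact (rightPerp_torf A _).sub _ _ hX
                (inferInstanceAs (Module.Finite A (LinearMap.ker h)))
                ⟨(LinearMap.ker h).subtype, Subtype.val_injective⟩
            · rw [← hm]
              have h1 : (LinearMap.ker h).restrictScalars K < ⊤ := by
                rw [lt_top_iff_ne_top]
                intro h2
                apply hh
                ext x : 1
                have : x ∈ (LinearMap.ker h).restrictScalars K := by rw [h2]; trivial
                exact this
              exact Submodule.finrank_lt h1.ne
          · exact hF.sub _ _ hN' (inferInstanceAs (Module.Finite A (X ⧸ LinearMap.ker h)))
              ⟨(LinearMap.ker h).liftQ h le_rfl, by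
                rw [← LinearMap.ker_eq_bot]
                exact Submodule.ker_liftQ_eq_bot _ _ _ le_rfl⟩
    let _ : Module K X := Module.compHom X (algebraMap K A)
    have _ : IsScalarTower K A X := ⟨fun k a x => by
      change (k • a) • x = (algebraMap K A k) • (a • x)
      rw [Algebra.smul_def, mul_smul]⟩
    exact main _ X rfl hX
  · intro hX
    apply hX _ (rightPerp_torf A _)
    rintro Y rfl
    exact ⟨inferInstanceAs (Module.Finite A (testMod K eJ a)), fun M hM f =>
      hom_testMod_eq_zero K eI eJ a hJ hM.2 f⟩


lemma finrank_le_of_surj {A : Type} [Ring A] (K : Type) [Field K] [Algebra K A] {I J : Type}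
    [Fintype I] [Fintype J] (eI : I → A) (eJ : J → A) (a : J → I → A)
    (ha : ∀ j i, eJ j * a j i = a j i)
    {X : Type} [AddCommGroup X] [Module A X] [Module K X] [IsScalarTower K A X]
    [FiniteDimensional K X] (hX : Surj eI eJ a X) :
    ∑ j, Module.finrank K (eSub K (eJ j) X) ≤ ∑ i, Module.finrank K (eSub K (eI i) X) := by
  rw [← Module.finrank_pi_fintype K, ← Module.finrank_pi_fintype K]
  let f : (∀ i, eSub K (eI i) X) →ₗ[K] (∀ j, eSub K (eJ j) X) :=
    LinearMap.pi fun j => LinearMap.codRestrict (eSub K (eJ j) X)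
      (∑ i, (Algebra.lsmul K K X (a j i)) ∘ₗ (eSub K (eI i) X).subtype ∘ₗ LinearMap.proj i)
      (by
        intro v
        rw [mem_eSub, LinearMap.sum_apply, Finset.smul_sum]
        apply Finset.sum_congr rfl
        intro i _
        change eJ j • a j i • (v i : X) = a j i • (v i : X)
        rw [← mul_smul, ha])
  have hf : ∀ v j, ((f v j : eSub K (eJ j) X) : X) = ∑ i, a j i • (v i : X) := by
    intro v j
    change (∑ i, (Algebra.lsmul K K X (a j i)) ∘ₗ (eSub K (eI i) X).subtype ∘ₗ
      LinearMap.proj i : (∀ i, eSub K (eI i) X) →ₗ[K] X) v = _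
    rw [LinearMap.sum_apply]
    rfl
  apply LinearMap.finrank_le_finrank_of_surjective (f := f)
  intro w
  obtain ⟨v, hv, hvw⟩ := hX (fun j => (w j : X)) (fun j => (w j).2)
  refine ⟨fun i => ⟨v i, hv i⟩, ?_⟩
  funext j
  apply Subtype.ext
  rw [hf]
  exact hvw j

lemma exists_surj {A : Type} [Ring A] (K : Type) [Field K] [IsAlgClosed K] [Algebra K A]
    [FiniteDimensional K A] {I J : Type}
    [Fintype I] [Fintype J] (eI : I → A) (eJ : J → A)
    (hI : ∀ i, IsIdempotentElem (eI i)) (hJ : ∀ j, IsIdempotentElem (eJ j))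
    (M : Type) [AddCommGroup M] [Module A M] [Module K M] [IsScalarTower K A M]
    [FiniteDimensional K M]
    (hL : ∀ L : Submodule A M, ∑ i, Module.finrank K (eSub K (eI i) L) +
      ∑ j, Module.finrank K (eSub K (eJ j) M) ≤ ∑ i, Module.finrank K (eSub K (eI i) M) +
      ∑ j, Module.finrank K (eSub K (eJ j) L)) :
    ∃ (l : ℕ) (a : J × Fin l → I × Fin l → A), 0 < l ∧
      (∀ j i, eJ j.1 * a j i = a j i) ∧ (∀ j i, a j i * eI i.1 = a j i) ∧
      Surj (fun i : I × Fin l => eI i.1) (fun j : J × Fin l => eJ j.1) a M := by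
  classical
  let b := Module.finBasis K A
  let E : ∀ j, M →ₗ[K] (∀ j, eSub K (eJ j) M) := fun j =>
    LinearMap.single K (fun j => eSub K (eJ j) M) j ∘ₗ
      LinearMap.codRestrict (eSub K (eJ j) M) (Algebra.lsmul K K M (eJ j))
      (by
        intro m
        change eJ j • eJ j • m = eJ j • m
        rw [← mul_smul, (hJ j).eq])
  have hE : ∀ j m, ((E j m j : eSub K (eJ j) M) : M) = eJ j • m := by
    intro j m
    simp [E]
  have hE' : ∀ j j' m, j' ≠ j → E j m j' = 0 := by
    intro j j' m h
    simp [E, Pi.single_eq_of_ne h]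
  let B : J × I × Fin (Module.finrank K A) → (∀ i, eSub K (eI i) M) →ₗ[K] (∀ j, eSub K (eJ j) M) :=
    fun t => E t.1 ∘ₗ (Algebra.lsmul K K M (b t.2.2)) ∘ₗ (eSub K (eI t.2.1) M).subtype ∘ₗ
      LinearMap.proj t.2.1
  have hBdef : ∀ t v, B t v = E t.1 (b t.2.2 • (v t.2.1 : M)) := fun t v => rfl
  have hBU : ∀ U : Submodule K (∀ i, eSub K (eI i) M), Module.finrank K U +
      Module.finrank K (∀ j, eSub K (eJ j) M) ≤ Module.finrank K (∀ i, eSub K (eI i) M) +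
        Module.finrank K (⨆ i, U.map (B i) : Submodule K (∀ j, eSub K (eJ j) M)) := by
    intro U
    let L : Submodule A M := Submodule.span A {m | ∃ u ∈ U, ∃ i, (u i : M) = m}
    have hLf : Module.Finite K L :=
      inferInstanceAs (Module.Finite K (L.restrictScalars K))
    have h1 : Module.finrank K U ≤ ∑ i, Module.finrank K (eSub K (eI i) L) := by
      rw [← Module.finrank_pi_fintype K]
      have hmem : ∀ (u : U) i, ((u.1 i : eSub K (eI i) M) : M) ∈ L :=
        fun u i => Submodule.subset_span ⟨u.1, u.2, i, rfl⟩
      let g : U →ₗ[K] (∀ i, eSub K (eI i) L) :=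
        { toFun := fun u i => ⟨⟨((u.1 i : eSub K (eI i) M) : M), hmem u i⟩, by
            rw [mem_eSub]
            apply Subtype.ext
            exact (u.1 i).2⟩
          map_add' := fun u v => rfl
          map_smul' := fun k u => rfl }
      apply LinearMap.finrank_le_finrank_of_injective (f := g)
      intro u v huv
      apply Subtype.ext
      funext i
      apply Subtype.ext
      exact congrArg (fun z => ((z i : eSub K (eI i) L) : L).1) huv
    have hspan : ∀ m ∈ L, ∀ j (c : A), E j (c • m) ∈
        (⨆ i, U.map (B i) : Submodule K (∀ j, eSub K (eJ j) M)) := by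
      intro m hm j
      induction hm using Submodule.span_induction with
      | mem m hm =>
        obtain ⟨u, hu, i, rfl⟩ := hm
        intro c
        rw [← b.sum_repr c, Finset.sum_smul, map_sum]
        apply Submodule.sum_mem
        intro s _
        rw [smul_assoc, map_smul]
        apply Submodule.smul_mem
        apply Submodule.mem_iSup_of_mem (j, i, s)
        exact ⟨u, hu, rfl⟩
      | zero =>
        intro c
        rw [smul_zero, map_zero]
        exact Submodule.zero_mem _
      | add x y _ _ hx hy =>
        intro c
        rw [smul_add, map_add]
        exact Submodule.add_mem _ (hx c) (hy c)
      | smul d x _ hx =>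
        intro c
        rw [← mul_smul]
        exact hx _
    have h2 : ∑ j, Module.finrank K (eSub K (eJ j) L) ≤
        Module.finrank K (⨆ i, U.map (B i) : Submodule K (∀ j, eSub K (eJ j) M)) := by
      rw [← Module.finrank_pi_fintype K]
      let g0 : (∀ j, eSub K (eJ j) L) →ₗ[K] (∀ j, eSub K (eJ j) M) :=
        { toFun := fun u j => ⟨((u j : eSub K (eJ j) L) : L).1,
            congrArg Subtype.val (u j).2⟩
          map_add' := fun u v => rfl
          map_smul' := fun k u => rfl }
      let g := LinearMap.codRestrict
        (⨆ i, U.map (B i) : Submodule K (∀ j, eSub K (eJ j) M)) g0 (by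
          intro u
          have : g0 u = ∑ j, E j ((1 : A) • ((u j : eSub K (eJ j) L) : L).1) := by
            funext j
            rw [Finset.sum_apply, Finset.sum_eq_single j]
            · apply Subtype.ext
              rw [hE, one_smul]
              exact (congrArg Subtype.val (u j).2).symm
            · intro j' _ h
              exact hE' _ _ _ h.symm
            · intro h
              exact absurd (Finset.mem_univ _) h
          rw [this]
          exact Submodule.sum_mem _ fun j _ => hspan _ (u j).1.2 _ _)
      apply LinearMap.finrank_le_finrank_of_injective (f := g)
      intro u v huv
      funext j
      apply Subtype.ext
      apply Subtype.ext
      exact congrArg (fun z => ((z.1 j : eSub K (eJ j) M) : M)) huv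
    have h3 := hL L
    rw [Module.finrank_pi_fintype K, Module.finrank_pi_fintype K]
    omega
  obtain ⟨l, x, hl, hx⟩ := la_main B hBU
  refine ⟨l, fun j i => ∑ s, x (j.1, i.1, s) j.2 i.2 • (eJ j.1 * b s * eI i.1), hl, ?_, ?_, ?_⟩
  · intro j i
    rw [Finset.mul_sum]
    apply Finset.sum_congr rfl
    intro s _
    rw [mul_smul_comm, ← mul_assoc, ← mul_assoc, (hJ _).eq]
  · intro j i
    rw [Finset.sum_mul]
    apply Finset.sum_congr rfl
    intro s _
    rw [smul_mul_assoc, mul_assoc, (hI _).eq]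
  · intro w hw
    obtain ⟨v, hv⟩ := hx (fun p j => ⟨w (j, p), hw (j, p)⟩)
    refine ⟨fun i => (v i.2 i.1 : M), fun i => (v i.2 i.1).2, ?_⟩
    rintro ⟨j, p⟩
    have h1 := congrArg (fun z => ((z p j : eSub K (eJ j) M) : M)) hv
    simp only [bigL_apply] at h1
    rw [← h1]
    have h2 : ∀ (F : ∀ j, eSub K (eJ j) M), ((F j : eSub K (eJ j) M) : M) =
      ((eSub K (eJ j) M).subtype ∘ₗ LinearMap.proj j) F := fun F => rfl
    rw [h2]
    simp only [map_sum, map_smul]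
    simp only [← h2, hBdef]
    refine Eq.trans ?_ (Eq.trans (Fintype.sum_prod_type _) (Finset.sum_eq_single j ?_ ?_)).symm
    · refine Eq.trans (Fintype.sum_prod_type _) (Eq.trans ?_ (Fintype.sum_prod_type _).symm)
      apply Finset.sum_congr rfl
      intro i _
      simp only [Finset.sum_smul]
      rw [Finset.sum_comm]
      apply Finset.sum_congr rfl
      intro s _
      apply Finset.sum_congr rfl
      intro q _
      have h3 : eI i • (v q i : M) = v q i := (v q i).2
      rw [hE, smul_assoc, mul_smul, mul_smul, h3]
    · intro j' _ hj
      apply Finset.sum_eq_zero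
      intro t _
      apply Finset.sum_eq_zero
      intro q _
      rw [hE' _ _ _ hj.symm]
      simp
    · intro h
      exact absurd (Finset.mem_univ _) h

lemma sum_fst_mul {α : Type} [Fintype α] (l : ℕ) (f : α → ℕ) :
    ∑ p : α × Fin l, f p.1 = l * ∑ i, f i := by
  rw [Fintype.sum_prod_type, Finset.mul_sum]
  simp

theorem main_aux (K : Type) [Field K] [IsAlgClosed K] [Algebra K A] [FiniteDimensional K A]
    (θ : ModuleCat.{0} A → ℝ) (hθ : IsStability A θ)
    (hint : ∀ M : ModuleCat.{0} A, Module.Finite A M → ∃ k : ℤ, θ M = (k : ℝ))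
    (hc : IsCompactTors A (tThetaBar A θ)) :
    IsCocompactTors A (tThetaBar A θ) := by
  have : IsNoetherianRing A := IsNoetherianRing.of_finite K A
  obtain ⟨I, J, _, _, eI, eJ, c, hc0, hI, hJ, hform⟩ := theta_formula K θ hθ hint
  obtain ⟨M, hM, hTM⟩ := hc
  have hMT : tThetaBar A θ M := by
    rw [hTM]
    exact fun T _ h => h M rfl
  have hcR : (0 : ℝ) < c := by exact_mod_cast hc0
  have hex : ∃ (l : ℕ) (a : J × Fin l → I × Fin l → A), 0 < l ∧
      (∀ j i, eJ j.1 * a j i = a j i) ∧ (∀ j i, a j i * eI i.1 = a j i) ∧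
      Surj (fun i : I × Fin l => eI i.1) (fun j : J × Fin l => eJ j.1) a M := by
    let _ : Module K M := Module.compHom M (algebraMap K A)
    have _ : IsScalarTower K A M := ⟨fun k a x => by
      change (k • a) • x = (algebraMap K A k) • (a • x)
      rw [Algebra.smul_def, mul_smul]⟩
    have _ : FiniteDimensional K M := Module.Finite.trans A M
    apply exists_surj K eI eJ hI hJ M
    intro L
    have hq : 0 ≤ θ (ModuleCat.of A (M ⧸ L)) :=
      hMT.2 (ModuleCat.of A (M ⧸ L)) (inferInstanceAs (Module.Finite A (M ⧸ L)))
        ⟨L.mkQ, L.mkQ_surjective⟩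
    have hadd := hθ (ModuleCat.of A L) M (ModuleCat.of A (M ⧸ L))
      (inferInstanceAs (Module.Finite A L)) hM (inferInstanceAs (Module.Finite A (M ⧸ L)))
      L.subtype L.mkQ L.subtype_injective L.mkQ_surjective (by
        rw [Submodule.range_subtype, Submodule.ker_mkQ])
    have f1 := hform M
    have f2 := hform L
    have hle : (c : ℝ) * θ (ModuleCat.of A L) ≤ c * θ (ModuleCat.of A M) := by
      apply mul_le_mul_of_nonneg_left _ hcR.le
      change _ ≤ θ M
      linarith
    rw [f1, f2] at hle
    have : ((∑ i, Module.finrank K (eSub K (eI i) L) +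
      ∑ j, Module.finrank K (eSub K (eJ j) M) : ℕ) : ℝ) ≤
      ((∑ i, Module.finrank K (eSub K (eI i) M) +
      ∑ j, Module.finrank K (eSub K (eJ j) L) : ℕ) : ℝ) := by
      rw [Nat.cast_add, Nat.cast_add]
      linarith
    exact_mod_cast this
  obtain ⟨l, a, hl, ha, ha', hS⟩ := hex
  have hT := surj_torsion (fun i : I × Fin l => eI i.1) (fun j : J × Fin l => eJ j.1) a
    (fun i => hI _) (fun j => hJ _) ha
  have hEq : tThetaBar A θ = fun X : ModuleCat.{0} A => Module.Finite A X ∧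
      Surj (fun i : I × Fin l => eI i.1) (fun j : J × Fin l => eJ j.1) a X := by
    funext X
    apply propext
    constructor
    · intro hX
      rw [hTM] at hX
      exact hX _ hT (fun Y hY => by subst hY; exact ⟨hM, hS⟩)
    · intro hX
      refine ⟨hX.1, fun Y hY hYX => ?_⟩
      have hY' := (hT.quot X Y hX hY hYX).2
      let _ : Module K Y := Module.compHom Y (algebraMap K A)
      have _ : IsScalarTower K A Y := ⟨fun k a x => by
        change (k • a) • x = (algebraMap K A k) • (a • x)
        rw [Algebra.smul_def, mul_smul]⟩
      have _ : FiniteDimensional K Y := Module.Finite.trans A Y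
      have h1 := finrank_le_of_surj K _ _ a ha hY'
      have h1' := (sum_fst_mul l (fun j => Module.finrank K (eSub K (eJ j) Y))).symm.le.trans
        (h1.trans (sum_fst_mul l (fun i => Module.finrank K (eSub K (eI i) Y))).le)
      have h2 := Nat.le_of_mul_le_mul_left h1' hl
      have h3 := hform Y
      have h4 : ((∑ j, Module.finrank K (eSub K (eJ j) Y) : ℕ) : ℝ) ≤
        ((∑ i, Module.finrank K (eSub K (eI i) Y) : ℕ) : ℝ) := by exact_mod_cast h2
      have h5 : 0 ≤ (c : ℝ) * θ (ModuleCat.of A Y) := by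
        rw [h3]
        linarith
      exact nonneg_of_mul_nonneg_right h5 hcR
  rw [hEq]
  exact surj_cocompact K _ _ a (fun i => hI _) (fun j => hJ _) ha ha'

/-- Over an algebraically closed field, for an integer-valued stability
function `θ` (a lattice point), if `\bar T_θ` is compact then it is cocompact. -/
theorem stmt4 (K : Type) [Field K] [IsAlgClosed K] [Algebra K A] [FiniteDimensional K A]
    (θ : ModuleCat.{0} A → ℝ) (hθ : IsStability A θ)
    (hint : ∀ M : ModuleCat.{0} A, Module.Finite A M → ∃ k : ℤ, θ M = (k : ℝ))
    (hc : IsCompactTors A (tThetaBar A θ)) :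
    IsCocompactTors A (tThetaBar A θ) := by
  exact main_aux A K θ hθ hint hc
end TorsPaper
end

section
/- Let K be a field, A a finite dimensional K-algebra, 𝒯 a torsion class and ℱ a torsion-free class in mod A, and assume both 𝒯 and ℱ are polyhedral. Then 𝒯 and ℱ are numerically disjoint if and only if there exists a stability function θ on mod A such that 𝒯 ⊆ T_θ and ℱ ⊆ F_θ. (Moreover, without the polyhedrality assumption, the existence of such θ always implies that 𝒯 and ℱ are numerically disjoint.) -/
namespace TorsPaper

variable (A : Type) [Ring A]

/-- Data identifying `K0(mod A)` with `ℤ^n`: a complete family `S` of pairwise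
non-isomorphic simple modules together with the dimension-vector function `d`,
characterized by additivity on short exact sequences and `d (S i) = eᵢ`. -/
structure DimData (n : ℕ) (S : Fin n → ModuleCat.{0} A)
    (d : ModuleCat.{0} A → (Fin n → ℤ)) : Prop where
  simple : ∀ i, IsSimpleModule A (S i)
  fin : ∀ i, Module.Finite A (S i)
  complete : ∀ M : ModuleCat.{0} A, Module.Finite A M → IsSimpleModule A M →
    ∃ i, Nonempty (M ≃ₗ[A] S i)
  distinct : ∀ i j, Nonempty ((S i) ≃ₗ[A] (S j)) → i = j
  additive : ∀ L M N : ModuleCat.{0} A, Module.Finite A L → Module.Finite A M →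
    Module.Finite A N → ∀ (f : L →ₗ[A] M) (g : M →ₗ[A] N), Function.Injective f →
      Function.Surjective g → LinearMap.range f = LinearMap.ker g → d M = d L + d N
  basis : ∀ i, d (S i) = Pi.single i 1

/-- The convex cone in `ℝ^n` generated by a set `S`. -/
def coneGen (n : ℕ) (S : Set (Fin n → ℝ)) : Set (Fin n → ℝ) :=
  { x | ∃ (m : ℕ) (c : Fin m → ℝ) (v : Fin m → (Fin n → ℝ)),
      (∀ i, 0 ≤ c i) ∧ (∀ i, v i ∈ S) ∧ x = ∑ i, c i • v i }

/-- The set of (real) dimension vectors of the modules in a class `C`. -/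
def dimVecSet (n : ℕ) (d : ModuleCat.{0} A → (Fin n → ℤ)) (C : ModuleCat.{0} A → Prop) :
    Set (Fin n → ℝ) :=
  { x | ∃ M : ModuleCat.{0} A, C M ∧ x = fun i => ((d M i : ℤ) : ℝ) }

/-- `cone C`: the convex cone generated by the dimension vectors of the modules in `C`. -/
def cone (n : ℕ) (d : ModuleCat.{0} A → (Fin n → ℤ)) (C : ModuleCat.{0} A → Prop) :
    Set (Fin n → ℝ) :=
  coneGen n (dimVecSet A n d C)

/-- A class `C` is polyhedral if `cone C` is a finitely generated (polyhedral) cone. -/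
def IsPolyhedral (n : ℕ) (d : ModuleCat.{0} A → (Fin n → ℤ))
    (C : ModuleCat.{0} A → Prop) : Prop :=
  ∃ (m : ℕ) (v : Fin m → (Fin n → ℝ)), cone A n d C = coneGen n (Set.range v)



/-- Gordan's alternative over `ℚ`, with natural number coefficients. -/
theorem gordanQ {ι : Type} [DecidableEq ι] (s : Finset ι) :
    ∀ (V : Type) [AddCommGroup V] [Module ℚ V] (w : ι → V),
      (∃ θ : V →ₗ[ℚ] ℚ, ∀ i ∈ s, 0 < θ (w i)) ∨
      (∃ a : ι → ℕ, (∃ i ∈ s, a i ≠ 0) ∧ ∑ i ∈ s, a i • w i = 0) := by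
  induction s using Finset.induction_on with
  | empty => intro V _ _ w; left; exact ⟨0, by simp⟩
  | insert j s hj ih =>
    intro V _ _ w
    have hne : ∀ i ∈ s, i ≠ j := fun i hi h => hj (h ▸ hi)
    rcases ih V w with ⟨θ1, h1⟩ | ⟨a, ⟨i, hi, hai⟩, hsum⟩
    swap
    · right
      refine ⟨fun i => if i = j then 0 else a i,
        ⟨i, Finset.mem_insert_of_mem hi, by simpa [hne i hi] using hai⟩, ?_⟩
      rw [Finset.sum_insert hj]
      simp only [if_true, zero_smul, zero_add]
      rw [← hsum]
      exact Finset.sum_congr rfl fun i hi => by simp [hne i hi]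
    by_cases hw : w j = 0
    · right
      refine ⟨fun i => if i = j then 1 else 0, ⟨j, by simp, by simp⟩, ?_⟩
      rw [Finset.sum_insert hj]
      simp only [if_true, hw, smul_zero, zero_add]
      exact Finset.sum_eq_zero fun i hi => by simp [hne i hi]
    rcases ih (V ⧸ Submodule.span ℚ {w j}) (fun i => Submodule.Quotient.mk (w i)) with
      ⟨θ, h⟩ | ⟨a, ⟨i, hi, hai⟩, hsum⟩
    · left
      obtain ⟨φ, hφ⟩ : ∃ φ : V →ₗ[ℚ] ℚ, 0 < φ (w j) := by
        have : ¬ ∀ φ : Module.Dual ℚ V, φ (w j) = 0 := by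
          rwa [Module.forall_dual_apply_eq_zero_iff]
        push Not at this
        obtain ⟨φ, hφ⟩ := this
        rcases lt_or_gt_of_ne hφ with h | h
        · exact ⟨-φ, by simpa using h⟩
        · exact ⟨φ, h⟩
      set ψ : V →ₗ[ℚ] ℚ := θ.comp (Submodule.mkQ _) with hψ
      have hψ0 : ψ (w j) = 0 := by
        have : (Submodule.mkQ (Submodule.span ℚ {w j})) (w j) = 0 := by
          simpa using Submodule.mem_span_singleton_self (w j)
        rw [hψ, LinearMap.comp_apply, this, map_zero]
      have hψ1 : ∀ i ∈ s, 0 < ψ (w i) := h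
      obtain ⟨N, hN⟩ := (s.image fun i => -φ (w i) / ψ (w i)).exists_le
      refine ⟨(N + 1) • ψ + φ, fun i hi => ?_⟩
      rcases Finset.mem_insert.1 hi with rfl | hi
      · simpa [hψ0] using hφ
      · have h2 := hN _ (Finset.mem_image_of_mem _ hi)
        have h3 := hψ1 i hi
        rw [div_le_iff₀ h3] at h2
        simp only [LinearMap.add_apply, LinearMap.smul_apply, smul_eq_mul]
        nlinarith
    · have hmem : ∑ i ∈ s, a i • w i ∈ Submodule.span ℚ {w j} := by
        rw [← Submodule.Quotient.mk_eq_zero, ← hsum]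
        change Submodule.mkQ _ _ = ∑ i ∈ s, a i • Submodule.mkQ _ _
        rw [map_sum]
        exact Finset.sum_congr rfl fun i _ => by rw [map_nsmul]
      obtain ⟨c, hc⟩ := Submodule.mem_span_singleton.1 hmem
      rcases le_or_gt c 0 with hc0 | hc0
      · right
        have hnum : c.num ≤ 0 := Rat.num_nonpos.2 hc0
        refine ⟨fun i => if i = j then c.num.natAbs else c.den * a i,
          ⟨i, Finset.mem_insert_of_mem hi, by simpa [hne i hi] using hai⟩, ?_⟩
        rw [Finset.sum_insert hj]
        have e1 : ∑ i ∈ s, (if i = j then c.num.natAbs else c.den * a i) • w i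
            = (c.den : ℚ) • (c • w j) := by
          rw [hc, Finset.smul_sum]
          refine Finset.sum_congr rfl fun i hi => ?_
          rw [if_neg (hne i hi), mul_smul, Nat.cast_smul_eq_nsmul]
        beta_reduce
        rw [e1, smul_smul, if_pos rfl, ← Nat.cast_smul_eq_nsmul ℚ, ← add_smul]
        have : ((c.num.natAbs : ℕ) : ℚ) + (c.den : ℚ) * c = 0 := by
          rw [mul_comm, Rat.mul_den_eq_num]
          have : ((c.num.natAbs : ℕ) : ℤ) + c.num = 0 := by omega
          have h7 := congrArg (fun z : ℤ => (z : ℚ)) this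
          simp only [Int.cast_add, Int.cast_natCast, Int.cast_zero] at h7
          exact h7
        rw [this, zero_smul]
      · left
        refine ⟨θ1, fun k hk => ?_⟩
        rcases Finset.mem_insert.1 hk with rfl | hk
        · have h4 : c * θ1 (w k) = ∑ i ∈ s, (a i : ℚ) * θ1 (w i) := by
            have := congrArg θ1 hc
            simpa [map_sum, map_nsmul] using this
          have h5 : 0 < ∑ i ∈ s, (a i : ℚ) * θ1 (w i) :=
            Finset.sum_pos' (fun i hi => mul_nonneg (Nat.cast_nonneg _) (h1 i hi).le)
              ⟨i, hi, mul_pos (by exact_mod_cast Nat.pos_of_ne_zero hai) (h1 i hi)⟩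
          rw [← h4] at h5
          exact pos_of_mul_pos_right h5 hc0.le
        · exact h1 k hk

section additive

variable {A}
variable {G : Type} [AddCommGroup G]

/-- additivity on short exact sequences for a function valued in an abelian group. -/
def IsAdd (A : Type) [Ring A] {G : Type} [AddCommGroup G] (g : ModuleCat.{0} A → G) : Prop :=
  ∀ L M N : ModuleCat.{0} A, Module.Finite A L → Module.Finite A M → Module.Finite A N →
    ∀ (f : L →ₗ[A] M) (h : M →ₗ[A] N), Function.Injective f → Function.Surjective h →
      LinearMap.range f = LinearMap.ker h → g M = g L + g N

theorem IsAdd.subsingleton {g : ModuleCat.{0} A → G} (hg : IsAdd A g) (M : ModuleCat.{0} A)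
    [Subsingleton M] : g M = 0 := by
  have : g M = g M + g M := hg M M M inferInstance inferInstance inferInstance
    LinearMap.id LinearMap.id Function.injective_id Function.surjective_id
    (Subsingleton.elim _ _)
  simpa using this

theorem IsAdd.iso {g : ModuleCat.{0} A → G} (hg : IsAdd A g) (M N : ModuleCat.{0} A)
    (hM : Module.Finite A M) (e : M ≃ₗ[A] N) : g M = g N := by
  have h0 : g (ModuleCat.of A PUnit) = 0 := by
    haveI : Subsingleton (ModuleCat.of A PUnit) := inferInstanceAs (Subsingleton PUnit)
    exact hg.subsingleton _
  have := hg (ModuleCat.of A PUnit) M N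
    (inferInstanceAs (Module.Finite A PUnit)) hM (Module.Finite.equiv e) 0 e.toLinearMap
    (fun x y _ => rfl) e.surjective (by simp)
  rw [this, h0, zero_add]

theorem IsAdd.sub {g : ModuleCat.{0} A → G} (hg : IsAdd A g) [IsNoetherianRing A]
    (M : Type) [AddCommGroup M] [Module A M] [Module.Finite A M] (N : Submodule A M) :
    g (ModuleCat.of A M) = g (ModuleCat.of A N) + g (ModuleCat.of A (M ⧸ N)) :=
  hg (ModuleCat.of A N) (ModuleCat.of A M) (ModuleCat.of A (M ⧸ N))
    (inferInstanceAs (Module.Finite A N)) (inferInstanceAs (Module.Finite A M))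
    (inferInstanceAs (Module.Finite A (M ⧸ N))) N.subtype N.mkQ
    N.injective_subtype N.mkQ_surjective (by simp)

theorem mod_induction [IsArtinianRing A] (P : ModuleCat.{0} A → Prop)
    (h0 : ∀ M : ModuleCat.{0} A, Subsingleton M → P M)
    (h1 : ∀ (M : Type) [AddCommGroup M] [Module A M] [Module.Finite A M] (N : Submodule A M),
      IsSimpleModule A (M ⧸ N) → P (ModuleCat.of A N) → P (ModuleCat.of A M))
    (M : ModuleCat.{0} A) (hM : Module.Finite A M) : P M := by
  have key : ∀ (M : Type) [AddCommGroup M] [Module A M], IsFiniteLength A M →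
      Module.Finite A M → P (ModuleCat.of A M) := by
    intro M _ _ h
    induction h with
    | of_subsingleton => exact fun _ => h0 _ ‹_›
    | of_simple_quotient _ ih =>
      intro hf
      exact h1 _ _ ‹_› (ih inferInstance)
  exact key M (isFiniteLength_iff_isNoetherian_isArtinian.2 ⟨inferInstance, inferInstance⟩) hM

variable {n : ℕ} {S : Fin n → ModuleCat.{0} A} {d : ModuleCat.{0} A → (Fin n → ℤ)}

theorem DimData.isAdd (hd : DimData A n S d) : IsAdd A d := hd.additive

theorem DimData.eq_sum [IsArtinianRing A] (hd : DimData A n S d) {g : ModuleCat.{0} A → G}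
    (hg : IsAdd A g) (M : ModuleCat.{0} A) (hM : Module.Finite A M) :
    g M = ∑ i, d M i • g (S i) := by
  refine mod_induction (fun M => g M = ∑ i, d M i • g (S i)) ?_ ?_ M hM
  · intro M _
    simp [hg.subsingleton M, hd.isAdd.subsingleton M]
  · intro M _ _ _ N hs ih
    obtain ⟨i, ⟨e⟩⟩ := hd.complete (ModuleCat.of A (M ⧸ N))
      (inferInstanceAs (Module.Finite A (M ⧸ N))) hs
    have e1 := hg.iso _ _ (inferInstanceAs (Module.Finite A (M ⧸ N))) e
    have e2 := hd.isAdd.iso _ _ (inferInstanceAs (Module.Finite A (M ⧸ N))) e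
    rw [hg.sub M N, hd.isAdd.sub M N, e1, e2, ih, hd.basis]
    simp [add_smul, Finset.sum_add_distrib, Pi.single_apply, ite_smul]

theorem DimData.nonneg [IsArtinianRing A] (hd : DimData A n S d)
    (M : ModuleCat.{0} A) (hM : Module.Finite A M) : 0 ≤ d M := by
  refine mod_induction (fun M => 0 ≤ d M) ?_ ?_ M hM
  · intro M _
    simp [hd.isAdd.subsingleton M]
  · intro M _ _ _ N hs ih
    obtain ⟨i, ⟨e⟩⟩ := hd.complete (ModuleCat.of A (M ⧸ N))
      (inferInstanceAs (Module.Finite A (M ⧸ N))) hs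
    have e2 := hd.isAdd.iso _ _ (inferInstanceAs (Module.Finite A (M ⧸ N))) e
    rw [hd.isAdd.sub M N, e2, hd.basis]
    exact add_nonneg ih (Pi.single_nonneg.2 zero_le_one)

theorem DimData.ne_zero [IsArtinianRing A] (hd : DimData A n S d)
    (M : ModuleCat.{0} A) (hM : Module.Finite A M) (h : Nonzero A M) : d M ≠ 0 := by
  revert h
  refine mod_induction (fun M => Nonzero A M → d M ≠ 0) ?_ ?_ M hM
  · rintro M _ ⟨x, hx⟩
    exact absurd (Subsingleton.elim _ _) hx
  · intro M _ _ _ N hs ih _ h0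
    obtain ⟨i, ⟨e⟩⟩ := hd.complete (ModuleCat.of A (M ⧸ N))
      (inferInstanceAs (Module.Finite A (M ⧸ N))) hs
    have e2 := hd.isAdd.iso _ _ (inferInstanceAs (Module.Finite A (M ⧸ N))) e
    have h1 := hd.nonneg (ModuleCat.of A N) (inferInstanceAs (Module.Finite A N)) i
    rw [hd.isAdd.sub M N, e2, hd.basis] at h0
    have := congrFun h0 i
    simp at this h1
    omega

theorem DimData.nonzero (hd : DimData A n S d)
    (M : ModuleCat.{0} A) (h : d M ≠ 0) : Nonzero A M := by
  by_contra hM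
  simp only [Nonzero, not_exists, not_not] at hM
  haveI : Subsingleton M := ⟨fun x y => by rw [hM x, hM y]⟩
  exact h (hd.isAdd.subsingleton M)

/-- the set of dimension vectors of a class closed under extensions is a submonoid. -/
theorem DimData.sum_mem (hd : DimData A n S d) (C : ModuleCat.{0} A → Prop)
    (fin : ∀ M, C M → Module.Finite A M)
    (zero : ∀ M : ModuleCat.{0} A, (∀ x : M, x = 0) → C M)
    (iso : ∀ M N : ModuleCat.{0} A, C M → (M ≃ₗ[A] N) → C N)
    (ext : ∀ M : ModuleCat.{0} A, Module.Finite A M → ∀ N : Submodule A M,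
      C (ModuleCat.of A N) → C (ModuleCat.of A (M ⧸ N)) → C M) :
    ∃ D : AddSubmonoid (Fin n → ℤ), ∀ x, x ∈ D ↔ ∃ M, C M ∧ d M = x := by
  refine ⟨{ carrier := {x | ∃ M, C M ∧ d M = x}, zero_mem' := ?_, add_mem' := ?_ },
    fun x => Iff.rfl⟩
  · rintro _ _ ⟨M, hM, rfl⟩ ⟨N, hN, rfl⟩
    haveI := fin M hM
    haveI := fin N hN
    have hker : LinearMap.ker (LinearMap.snd A M N) = LinearMap.range (LinearMap.inl A M N) :=
      (LinearMap.range_inl A M N).symm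
    refine ⟨ModuleCat.of A (M × N), ext _ (inferInstanceAs (Module.Finite A (M × N)))
      (LinearMap.ker (LinearMap.snd A M N)) ?_ ?_, ?_⟩
    · refine iso M _ hM ?_
      exact (LinearEquiv.ofInjective (LinearMap.inl A M N) LinearMap.inl_injective).trans
        (LinearEquiv.ofEq _ _ hker.symm)
    · refine iso N _ hN ?_
      exact ((LinearMap.snd A M N).quotKerEquivOfSurjective LinearMap.snd_surjective).symm
    · exact hd.additive M (ModuleCat.of A (M × N)) N inferInstance
        (inferInstanceAs (Module.Finite A (M × N))) inferInstance
        (LinearMap.inl A M N) (LinearMap.snd A M N) LinearMap.inl_injective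
        LinearMap.snd_surjective hker.symm
  · haveI : Subsingleton (ModuleCat.of A PUnit) := inferInstanceAs (Subsingleton PUnit)
    exact ⟨ModuleCat.of A PUnit, zero _ fun x => Subsingleton.elim _ _, hd.isAdd.subsingleton _⟩

end additive

section cones

variable {A}
variable {n : ℕ} {d : ModuleCat.{0} A → (Fin n → ℤ)}

theorem coneGen_pos {S : Set (Fin n → ℝ)} (ℓ : (Fin n → ℝ) →ₗ[ℝ] ℝ)
    (h : ∀ x ∈ S, x = 0 ∨ 0 < ℓ x) : ∀ x ∈ coneGen n S, x = 0 ∨ 0 < ℓ x := by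
  rintro x ⟨m, c, v, hc, hv, rfl⟩
  have hnn : ∀ i, 0 ≤ ℓ (v i) := fun i => by
    rcases h _ (hv i) with h | h
    · simp [h]
    · exact h.le
  by_cases hall : ∀ i, c i • v i = 0
  · left; exact Finset.sum_eq_zero fun i _ => hall i
  · right
    push Not at hall
    obtain ⟨i, hi⟩ := hall
    rw [map_sum]
    refine Finset.sum_pos' (fun i _ => ?_) ⟨i, Finset.mem_univ _, ?_⟩
    · rw [map_smul]; exact mul_nonneg (hc i) (hnn i)
    · rw [map_smul]
      have h1 : c i ≠ 0 := fun h => hi (by rw [h, zero_smul])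
      have h2 : v i ≠ 0 := fun h => hi (by rw [h, smul_zero])
      exact mul_pos (lt_of_le_of_ne (hc i) h1.symm) ((h _ (hv i)).resolve_left h2)

theorem subset_coneGen {S : Set (Fin n → ℝ)} {x : Fin n → ℝ} (hx : x ∈ S) : x ∈ coneGen n S :=
  ⟨1, fun _ => 1, fun _ => x, by simp, by simpa using hx, by simp⟩

/-- A polyhedral class has finitely many dimension vectors controlling positivity. -/
theorem IsPolyhedral.finite {C : ModuleCat.{0} A → Prop} (h : IsPolyhedral A n d C) :
    ∃ W : Finset (Fin n → ℤ), (∀ x ∈ W, x ≠ 0 ∧ ∃ M, C M ∧ d M = x) ∧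
      ∀ ℓ : (Fin n → ℝ) →ₗ[ℝ] ℝ, (∀ x ∈ W, 0 < ℓ (fun i => (x i : ℝ))) →
        ∀ M, C M → d M ≠ 0 → 0 < ℓ (fun i => (d M i : ℝ)) := by
  classical
  obtain ⟨m, v, hv⟩ := h
  have h1 : ∀ j, v j ∈ cone A n d C := fun j => by
    rw [hv]; exact subset_coneGen ⟨j, rfl⟩
  choose k c u hc hu hs using h1
  choose X hX hXu using hu
  refine ⟨(Finset.univ.image fun p : (Σ j, Fin (k j)) => d (X p.1 p.2)).filter (· ≠ 0), ?_, ?_⟩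
  · intro x hx
    simp only [Finset.mem_filter, Finset.mem_image, Finset.mem_univ, true_and] at hx
    obtain ⟨⟨p, rfl⟩, h0⟩ := hx
    exact ⟨h0, _, hX _ _, rfl⟩
  · intro ℓ hℓ M hM h0
    have hpos : ∀ x ∈ Set.range v, x = 0 ∨ 0 < ℓ x := by
      rintro _ ⟨j, rfl⟩
      refine coneGen_pos (S := Set.range (u j)) ℓ ?_ (v j)
        ⟨k j, c j, u j, hc j, fun i => ⟨i, rfl⟩, hs j⟩
      rintro _ ⟨i, rfl⟩
      rw [hXu]
      by_cases hz : d (X j i) = 0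
      · left; ext t; simp [hz]
      · right
        refine hℓ _ (Finset.mem_filter.2 ⟨Finset.mem_image.2 ⟨⟨j, i⟩, Finset.mem_univ _, rfl⟩, hz⟩)
    have hmem : (fun i => (d M i : ℝ)) ∈ coneGen n (Set.range v) := by
      rw [← hv]; exact subset_coneGen ⟨M, hM, rfl⟩
    refine (coneGen_pos ℓ hpos _ hmem).resolve_left fun hz => h0 ?_
    ext t
    have := congrFun hz t
    simpa using this

end cones

/-- For a torsion class `𝒯` and a torsion-free class `ℱ` which are both
polyhedral, `𝒯` and `ℱ` are numerically disjoint iff there is a stability function `θ`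
with `𝒯 ⊆ T_θ` and `ℱ ⊆ F_θ`; moreover, without polyhedrality, the existence of such a
`θ` always implies numerical disjointness. -/
theorem stmt8 (K : Type) [Field K] [Algebra K A] [FiniteDimensional K A]
    (n : ℕ) (S : Fin n → ModuleCat.{0} A) (d : ModuleCat.{0} A → (Fin n → ℤ))
    (hd : DimData A n S d)
    (T F : ModuleCat.{0} A → Prop)
    (hT : IsTorsionClass A T) (hF : IsTorsionFreeClass A F) :
    ((IsPolyhedral A n d T ∧ IsPolyhedral A n d F) →
      ((¬ ∃ X Y : ModuleCat.{0} A, T X ∧ F Y ∧ Nonzero A X ∧ Nonzero A Y ∧ d X = d Y) ↔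
        ∃ θ : ModuleCat.{0} A → ℝ, IsStability A θ ∧
          (∀ M, T M → tTheta A θ M) ∧ (∀ M, F M → fTheta A θ M))) ∧
    ((∃ θ : ModuleCat.{0} A → ℝ, IsStability A θ ∧
        (∀ M, T M → tTheta A θ M) ∧ (∀ M, F M → fTheta A θ M)) →
      ¬ ∃ X Y : ModuleCat.{0} A, T X ∧ F Y ∧ Nonzero A X ∧ Nonzero A Y ∧ d X = d Y) := by
  haveI : IsArtinianRing A := IsArtinianRing.of_finite K A
  have hback : (∃ θ : ModuleCat.{0} A → ℝ, IsStability A θ ∧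
        (∀ M, T M → tTheta A θ M) ∧ (∀ M, F M → fTheta A θ M)) →
      ¬ ∃ X Y : ModuleCat.{0} A, T X ∧ F Y ∧ Nonzero A X ∧ Nonzero A Y ∧ d X = d Y := by
    rintro ⟨θ, hθ, h1, h2⟩ ⟨X, Y, hX, hY, hX0, hY0, he⟩
    have p1 := (h1 X hX).2 X (hT.fin X hX) ⟨LinearMap.id, Function.surjective_id⟩ hX0
    have p2 := (h2 Y hY).2 Y (hF.fin Y hY) ⟨LinearMap.id, Function.injective_id⟩ hY0
    rw [hd.eq_sum (g := θ) hθ X (hT.fin X hX), he,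
      ← hd.eq_sum (g := θ) hθ Y (hF.fin Y hY)] at p1
    exact lt_asymm p1 p2
  refine ⟨fun ⟨hPT, hPF⟩ => ⟨fun hdis => ?_, hback⟩, hback⟩
  classical
  obtain ⟨WT, hWT, hWT'⟩ := hPT.finite
  obtain ⟨WF, hWF, hWF'⟩ := hPF.finite
  obtain ⟨DT, hDT⟩ := hd.sum_mem T hT.fin hT.zero
    (fun M N hM e => hT.quot M N hM (haveI := hT.fin M hM; Module.Finite.equiv e)
      ⟨e.toLinearMap, e.surjective⟩) hT.ext
  obtain ⟨DF, hDF⟩ := hd.sum_mem F hF.fin hF.zero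
    (fun M N hM e => hF.sub M N hM (haveI := hF.fin M hM; Module.Finite.equiv e)
      ⟨e.symm.toLinearMap, e.symm.injective⟩) hF.ext
  have hTn : ∀ x ∈ WT, 0 ≤ x ∧ x ≠ 0 := fun x hx => by
    obtain ⟨h0, M, hM, rfl⟩ := hWT x hx
    exact ⟨hd.nonneg M (hT.fin M hM), h0⟩
  have hFn : ∀ x ∈ WF, 0 ≤ x ∧ x ≠ 0 := fun x hx => by
    obtain ⟨h0, M, hM, rfl⟩ := hWF x hx
    exact ⟨hd.nonneg M (hF.fin M hM), h0⟩
  rcases gordanQ (WT.disjSum WF) (Fin n → ℚ)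
    (Sum.elim (fun x i => (x i : ℚ)) (fun x i => -(x i : ℚ))) with ⟨θ, hθ⟩ | ⟨a, hane, hsum⟩
  · -- the separating functional
    let t : Fin n → ℝ := fun i => ((θ (Pi.single i 1) : ℚ) : ℝ)
    let ℓ : (Fin n → ℝ) →ₗ[ℝ] ℝ := Fintype.linearCombination ℝ t
    have hℓ : ∀ x : Fin n → ℤ, ℓ (fun i => (x i : ℝ)) = ((θ (fun i => (x i : ℚ)) : ℚ) : ℝ) := by
      intro x
      rw [LinearMap.pi_apply_eq_sum_univ θ]
      simp only [ℓ, t, Fintype.linearCombination_apply, smul_eq_mul, Rat.cast_sum, Rat.cast_mul,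
        Rat.cast_intCast]
      refine Finset.sum_congr rfl fun i _ => ?_
      congr 3
      ext j
      simp [Pi.single_apply, eq_comm]
    have hposT : ∀ M, T M → Nonzero A M → 0 < ℓ (fun i => (d M i : ℝ)) := fun M hM h0 =>
      hWT' ℓ (fun x hx => by
        rw [hℓ]
        have := hθ (Sum.inl x) (Finset.inl_mem_disjSum.2 hx)
        exact_mod_cast this) M hM (hd.ne_zero M (hT.fin M hM) h0)
    have hposF : ∀ M, F M → Nonzero A M → ℓ (fun i => (d M i : ℝ)) < 0 := fun M hM h0 => by
      have := hWF' (-ℓ) (fun x hx => by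
        rw [LinearMap.neg_apply, hℓ]
        have := hθ (Sum.inr x) (Finset.inr_mem_disjSum.2 hx)
        simp only [Sum.elim_inr] at this
        have e : (fun i => -(x i : ℚ)) = -(fun i => (x i : ℚ)) := rfl
        rw [e, map_neg] at this
        exact_mod_cast this) M hM (hd.ne_zero M (hF.fin M hM) h0)
      simpa using this
    refine ⟨fun M => ℓ (fun i => (d M i : ℝ)), ?_, ?_, ?_⟩
    · intro L M N hL hM hN f g hf hg hfg
      simp only
      rw [← map_add, hd.additive L M N hL hM hN f g hf hg hfg]
      congr 1
      ext i
      simp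
    · exact fun M hM => ⟨hT.fin M hM, fun N hN hq h0 => hposT N (hT.quot M N hM hN hq) h0⟩
    · exact fun M hM => ⟨hF.fin M hM, fun N hN hq h0 => hposF N (hF.sub M N hM hN hq) h0⟩
  · exfalso
    rw [Finset.sum_disjSum] at hsum
    set x : Fin n → ℤ := ∑ w ∈ WT, a (Sum.inl w) • w with hx
    set y : Fin n → ℤ := ∑ w ∈ WF, a (Sum.inr w) • w with hy
    have hxy : x = y := by
      ext i
      have := congrFun hsum i
      simp only [Sum.elim_inl, Sum.elim_inr, Pi.add_apply, Finset.sum_apply, Pi.smul_apply,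
        Pi.zero_apply, smul_neg, Finset.sum_neg_distrib, nsmul_eq_mul, Pi.mul_apply,
        Pi.natCast_apply, mul_neg] at this
      have h2 : ((x i : ℤ) : ℚ) = ((y i : ℤ) : ℚ) := by
        rw [hx, hy]
        simp only [Finset.sum_apply, Pi.smul_apply, nsmul_eq_mul, Int.cast_sum, Int.cast_mul,
          Int.cast_natCast, Pi.mul_apply, Pi.natCast_apply]
        linarith
      exact_mod_cast h2
    have hxT : x ∈ DT := sum_mem fun w hw => nsmul_mem ((hDT w).2 (hWT w hw).2) _
    have hyF : y ∈ DF := sum_mem fun w hw => nsmul_mem ((hDF w).2 (hWF w hw).2) _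
    have aux : ∀ (W : Finset (Fin n → ℤ)) (b : (Fin n → ℤ) → ℕ), (∀ x ∈ W, 0 ≤ x ∧ x ≠ 0) →
        (∃ w ∈ W, b w ≠ 0) → ∑ w ∈ W, b w • w ≠ 0 := by
      rintro W b hW ⟨w, hw, hb⟩ h0
      have := (Finset.sum_eq_zero_iff_of_nonneg
        (fun w hw => nsmul_nonneg (hW w hw).1 (b w))).1 h0 w hw
      rcases smul_eq_zero.1 this with h | h
      · exact hb h
      · exact (hW w hw).2 h
    have hx0 : x ≠ 0 := by
      obtain ⟨i, hi, hai⟩ := hane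
      rcases i with w | w
      · exact aux WT _ hTn ⟨w, Finset.inl_mem_disjSum.1 hi, hai⟩
      · rw [hxy]
        exact aux WF _ hFn ⟨w, Finset.inr_mem_disjSum.1 hi, hai⟩
    obtain ⟨X, hX, hXx⟩ := (hDT x).1 hxT
    obtain ⟨Y, hY, hYy⟩ := (hDF y).1 hyF
    exact hdis ⟨X, Y, hX, hY, hd.nonzero X (hXx ▸ hx0), hd.nonzero Y (hYy ▸ hxy ▸ hx0),
      by rw [hXx, hYy, hxy]⟩

end TorsPaper
end
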